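/- Let m ≥ 2, k ≥ 1 and d ≥ 2 be integers. In the polynomial ring (ℤ/2)[x₁,...,x_m], for a nonempty subset S ⊆ {1,...,m} let ℓ_S denote the linear form Σ_{i∈S} x_i, and consider the polynomial Q = (Π_{i=2}^m x_i^k) · (Π_{S ⊆ {2,...,m}, |S| ≥ 2} ℓ_S) · (Π_{S ⊆ {1,...,m}, |S| ≥ 2} ℓ_S)^k (this equals (1/(x₂x₃⋯x_m))·𝔓_{m-1}(x₂,...,x_m)·(𝔓_m/x₁)^k, where 𝔓_m = Π_{∅≠S⊆{1,...,m}} ℓ_S is the Dickson polynomial). If Q does not belong to the ideal of (ℤ/2)[x₁,...,x_m] generated by x₁^d, x₂^d, ..., x_m^d, then every mass distribution μ on ℝ^d admits an equipartition into (2k+1)×2×⋯×2 boxes (with m-1 factors of 2) by a collection of 2k parallel hyperplanes orthogonal to some unit vector u₁ at levels t_1 < ... < t_{2k}, together with m-1 additional hyperplanes orthogonal to unit vectors u₂,...,u_m at levels s₂,...,s_m, the vectors u₁,...,u_m being pairwise non-parallel: each of the 2^{m-1}(2k+1) regions {x : t_i < ⟨x,u₁⟩ < t_{i+1}} ∩ ∩_{j=2}^m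 {x : ⟨x,u_j⟩ ≶ s_j} (with t_0 = -∞, t_{2k+1} = +∞ and every choice of sign for each j) has μ-measure μ(ℝ^d)/(2^{m-1}(2k+1)). -/

import Mathlib

open MeasureTheory

/-- The open slab between consecutive parallel hyperplanes orthogonal to `u`:
for `0 ≤ i ≤ n`, the region `{x : t i < ⟪x,u⟫ < t (i+1)}`, with the conventions
`t 0 = -∞` and `t (n+1) = +∞` (i.e. the corresponding inequality is dropped). -/
noncomputable def slab {d : ℕ} (u : EuclideanSpace ℝ (Fin d)) (t : ℕ → ℝ) (n i : ℕ) :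
    Set (EuclideanSpace ℝ (Fin d)) :=
  {x | (1 ≤ i → t i < (inner ℝ x u : ℝ)) ∧ (i + 1 ≤ n → (inner ℝ x u : ℝ) < t (i + 1))}

/-- The open halfspace below (`b = true`) or above (`b = false`) the hyperplane
orthogonal to `v` at level `s`. -/
def halfSp {d : ℕ} (v : EuclideanSpace ℝ (Fin d)) (s : ℝ) (b : Bool) :
    Set (EuclideanSpace ℝ (Fin d)) :=
  if b then {x | (inner ℝ x v : ℝ) < s} else {x | s < (inner ℝ x v : ℝ)}


namespace EqP
open Finset Function

section Grid
variable {I : Type*} [Fintype I] [DecidableEq I]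

/-- mod 2 coboundary on the cubical grid -/
def bd (f : (I → ℤ) → ZMod 2) (v : I → ℤ) : ZMod 2 :=
  ∑ q ∈ univ.filter (fun q => Odd (v q)),
    (f (update v q (v q + 1)) + f (update v q (v q - 1)))

/-- mod 2 count attached to cells -/
def gT (h : ℕ → (I → ℤ) → ZMod 2) : ℕ → (I → ℤ) → ZMod 2
  | 0 => fun _ => 1
  | n + 1 => bd (fun w => h n w * gT h n w)

theorem z2_add_self (x : ZMod 2) : x + x = 0 := CharTwo.add_self_eq_zero x

theorem filter_odd_update (v : I → ℤ) (q : I) (x : ℤ) (hx : Even x) :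
    univ.filter (fun p => Odd (update v q x p)) = (univ.filter (fun p => Odd (v p))).erase q := by
  ext p
  by_cases hp : p = q
  · subst hp; simp [hx]
  · simp [hp]

theorem bd_bd (f : (I → ℤ) → ZMod 2) (v : I → ℤ) : bd (bd f) v = 0 := by
  classical
  set O := univ.filter (fun p => Odd (v p)) with hO
  let g : I → I → ZMod 2 := fun q p =>
    (f (update (update v q (v q + 1)) p (v p + 1)) + f (update (update v q (v q + 1)) p (v p - 1)))
    + (f (update (update v q (v q - 1)) p (v p + 1)) + f (update (update v q (v q - 1)) p (v p - 1)))
  have h1 : bd (bd f) v = ∑ q ∈ O, ∑ p ∈ O.erase q, g q p := by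
    unfold bd
    refine Finset.sum_congr rfl ?_
    intro q hq
    have hq' : Odd (v q) := by simpa [hO] using hq
    rw [filter_odd_update v q _ (by exact hq'.add_one),
      filter_odd_update v q _ (by exact hq'.sub_odd odd_one), ← Finset.sum_add_distrib]
    refine Finset.sum_congr rfl ?_
    intro p hp
    have hpq : p ≠ q := (Finset.mem_erase.1 hp).1
    simp only [g, update_of_ne hpq]
  have h2 : ∑ q ∈ O, ∑ p ∈ O.erase q, g q p = ∑ x ∈ O.offDiag, g x.1 x.2 := by
    rw [Finset.sum_sigma']
    refine Finset.sum_bij' (fun x _ => (x.1, x.2)) (fun x _ => ⟨x.1, x.2⟩) ?_ ?_ ?_ ?_ ?_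
    · rintro ⟨a, b⟩ h; simp at h ⊢; exact ⟨h.1, h.2.2, fun e => h.2.1 e.symm⟩
    · rintro ⟨a, b⟩ h; simp at h ⊢; exact ⟨h.1, fun e => h.2.2 e.symm, h.2.1⟩
    · rintro ⟨a, b⟩ h; rfl
    · rintro ⟨a, b⟩ h; rfl
    · rintro ⟨a, b⟩ h; rfl
  rw [h1, h2]
  refine Finset.sum_involution (fun x _ => (x.2, x.1)) ?_ ?_ ?_ ?_
  · rintro ⟨a, b⟩ h
    have hab : a ≠ b := (Finset.mem_offDiag.1 h).2.2
    have : g b a = g a b := by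
      simp only [g]
      rw [update_comm hab.symm, update_comm hab.symm, update_comm hab.symm, update_comm hab.symm]
      ring
    simp only [this]
    exact z2_add_self _
  · rintro ⟨a, b⟩ h _ e
    simp at h e; exact h.2.2 e.2
  · rintro ⟨a, b⟩ h; simp at h ⊢; exact ⟨h.2.1, h.1, fun e => h.2.2 e.symm⟩
  · rintro ⟨a, b⟩ h; rfl

theorem bd_gT (h : ℕ → (I → ℤ) → ZMod 2) (n : ℕ) (v : I → ℤ) : bd (gT h n) v = 0 := by
  cases n with
  | zero =>
    unfold bd
    refine Finset.sum_eq_zero fun q _ => ?_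
    exact z2_add_self _
  | succ n => exact bd_bd _ _

/-- closed under taking facets -/
def FClosed (D : Set (I → ℤ)) : Prop :=
  ∀ v ∈ D, ∀ q, Odd (v q) → update v q (v q + 1) ∈ D ∧ update v q (v q - 1) ∈ D

theorem bd_congr {f g : (I → ℤ) → ZMod 2} {v : I → ℤ} {D : Set (I → ℤ)} (hD : FClosed D)
    (hv : v ∈ D) (hfg : ∀ w ∈ D, f w = g w) : bd f v = bd g v := by
  unfold bd
  refine Finset.sum_congr rfl fun q hq => ?_
  have := hD v hv q (by simpa using hq)
  rw [hfg _ this.1, hfg _ this.2]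

theorem bd_zero (v : I → ℤ) : bd (fun _ => 0) v = 0 := by simp [bd]

theorem bd_const_mul (c : ZMod 2) (f : (I → ℤ) → ZMod 2) (v : I → ℤ) :
    bd (fun w => c * f w) v = c * bd f v := by
  unfold bd
  rw [Finset.mul_sum]
  exact Finset.sum_congr rfl fun q _ => by ring

theorem bd_add (f g : (I → ℤ) → ZMod 2) (v : I → ℤ) :
    bd (fun w => f w + g w) v = bd f v + bd g v := by
  unfold bd
  rw [← Finset.sum_add_distrib]
  exact Finset.sum_congr rfl fun q _ => by ring

theorem gT_const {h : ℕ → (I → ℤ) → ZMod 2} {D : Set (I → ℤ)} (hD : FClosed D) (r : ℕ)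
    (c : ZMod 2) (hc : ∀ w ∈ D, h r w = c) (n : ℕ) (hn : r < n) : ∀ v ∈ D, gT h n v = 0 := by
  induction n with
  | zero => omega
  | succ n ih =>
    intro v hv
    rcases Nat.lt_or_ge r n with hr | hr
    · have : gT h (n+1) v = bd (fun _ => 0) v :=
        bd_congr hD hv fun w hw => by rw [ih hr w hw, mul_zero]
      rw [this, bd_zero]
    · have hrn : r = n := by omega
      subst hrn
      have : gT h (r+1) v = bd (fun w => c * gT h r w) v :=
        bd_congr hD hv fun w hw => by rw [hc w hw]
      rw [this, bd_const_mul, bd_gT, mul_zero]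

/-- reflect the coordinates in B -/
def refl (B : Finset I) (L : ℤ) (v : I → ℤ) : I → ℤ := fun q => if q ∈ B then 2 * L - v q else v q

theorem refl_odd (B : Finset I) (L : ℤ) (v : I → ℤ) (q : I) : Odd (refl B L v q) ↔ Odd (v q) := by
  unfold refl
  split_ifs
  · rw [Int.odd_sub]
    have : ¬ Odd (2 * L) := by simp
    simp [this]
  · rfl

theorem bd_refl (B : Finset I) (L : ℤ) (f : (I → ℤ) → ZMod 2) (v : I → ℤ) :
    bd f (refl B L v) = bd (fun w => f (refl B L w)) v := by
  unfold bd
  simp only [refl_odd]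
  refine Finset.sum_congr rfl fun q hq => ?_
  have key : ∀ x, refl B L (update v q x) =
      update (refl B L v) q (if q ∈ B then 2 * L - x else x) := by
    intro x; ext p
    by_cases hp : p = q
    · subst hp; simp [refl]
    · simp [refl, hp]
  rw [key, key]
  by_cases hB : q ∈ B
  · simp only [hB, if_true]
    rw [add_comm]
    congr 3 <;> simp [refl, hB] <;> ring
  · simp [refl, hB]

theorem gT_refl {h : ℕ → (I → ℤ) → ZMod 2} {D : Set (I → ℤ)} (hD : FClosed D) (B : Finset I)
    (L : ℤ) (c : ℕ → ZMod 2) (hc : ∀ r, ∀ w ∈ D, h r (refl B L w) = h r w + c r) (n : ℕ) :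
    ∀ v ∈ D, gT h n (refl B L v) = gT h n v := by
  induction n with
  | zero => intro v _; rfl
  | succ n ih =>
    intro v hv
    have : gT h (n+1) (refl B L v) = bd (fun w => h n w * gT h n w + c n * gT h n w) v := by
      rw [show gT h (n+1) (refl B L v) = bd (fun w => h n w * gT h n w) (refl B L v) from rfl,
        bd_refl]
      refine bd_congr hD hv fun w hw => ?_
      rw [hc n w hw, ih w hw]; ring
    rw [this, bd_add, bd_const_mul, bd_gT]
    simp [gT]

theorem gT_deg_even {h : ℕ → (I → ℤ) → ZMod 2} {D : Set (I → ℤ)} (hD : FClosed D) (q : I)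
    (hq : ∀ r, ∀ w ∈ D, ∀ x, h r (update w q x) = h r w) (n : ℕ) :
    ∀ v ∈ D, Even (v q) → ∀ x, Even x → gT h n (update v q x) = gT h n v := by
  induction n with
  | zero => intro v _ _ _ _; rfl
  | succ n ih =>
    intro v hv hvq x hx
    simp only [gT, bd]
    rw [filter_odd_update v q x hx, Finset.erase_eq_of_notMem (by simpa using hvq)]
    refine Finset.sum_congr rfl fun p hp => ?_
    have hp' : Odd (v p) := by simpa using hp
    have hpq : p ≠ q := by
      rintro rfl; exact (Int.not_even_iff_odd.2 hp') hvq
    have h1 := hD v hv p hp'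
    rw [update_of_ne hpq, update_comm hpq.symm, update_comm hpq.symm, hq _ _ h1.1, hq _ _ h1.2,
      ih _ h1.1 (by rwa [update_of_ne hpq.symm]) x hx, ih _ h1.2 (by rwa [update_of_ne hpq.symm]) x hx]

theorem gT_deg_odd {h : ℕ → (I → ℤ) → ZMod 2} {D : Set (I → ℤ)} (hD : FClosed D) (q : I)
    (hq : ∀ r, ∀ w ∈ D, ∀ x, h r (update w q x) = h r w) (n : ℕ) :
    ∀ v ∈ D, Odd (v q) → (univ.filter (fun p => Odd (v p))).card = n → gT h n v = 0 := by
  induction n with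
  | zero =>
    intro v hv hvq hc
    have : q ∈ univ.filter (fun p => Odd (v p)) := by simpa using hvq
    rw [Finset.card_eq_zero.1 hc] at this
    simp at this
  | succ n ih =>
    intro v hv hvq hc
    refine Finset.sum_eq_zero fun p hp => ?_
    have hp' : Odd (v p) := by simpa using hp
    have h1 := hD v hv p hp'
    by_cases hpq : p = q
    · subst hpq
      have e1 : update v p (v p - 1) = update (update v p (v p + 1)) p (v p - 1) := by simp
      have e2 : gT h n (update v p (v p - 1)) = gT h n (update v p (v p + 1)) := by
        rw [e1]
        exact gT_deg_even hD p hq n _ h1.1 (by simpa using hp'.add_one) _ (hp'.sub_odd odd_one)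
      have e3 : h n (update v p (v p - 1)) = h n (update v p (v p + 1)) := by
        rw [e1]
        exact hq n _ h1.1 _
      simp only [e2, e3]
      exact z2_add_self _
    · have hqp : q ≠ p := fun e => hpq e.symm
      have c : ∀ x, Even x → (univ.filter (fun a => Odd (update v p x a))).card = n := by
        intro x hx
        rw [filter_odd_update v p x hx, Finset.card_erase_of_mem hp, hc]; rfl
      simp only
      rw [ih _ h1.1 (by rwa [update_of_ne hqp]) (c _ hp'.add_one),
        ih _ h1.2 (by rwa [update_of_ne hqp]) (c _ (hp'.sub_odd odd_one))]
      simp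

/-- grid cells with odd coordinates in A, zero elsewhere -/
def cells (A : Finset I) (L : ℕ) : Finset (I → ℤ) :=
  Fintype.piFinset fun q => if q ∈ A then (range L).image (fun t : ℕ => (2 * t + 1 : ℤ)) else {0}

theorem mem_cells {A : Finset I} {L : ℕ} {v : I → ℤ} : v ∈ cells A L ↔
    ∀ q, (q ∈ A → ∃ t < L, (2 * t + 1 : ℤ) = v q) ∧ (q ∉ A → v q = 0) := by
  unfold cells
  rw [Fintype.mem_piFinset]
  refine forall_congr' fun q => ?_
  by_cases hq : q ∈ A <;> simp [hq]

theorem cells_odd {A : Finset I} {L : ℕ} {v : I → ℤ} (hv : v ∈ cells A L) :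
    univ.filter (fun q => Odd (v q)) = A := by
  ext q
  have := (mem_cells.1 hv) q
  by_cases hq : q ∈ A
  · obtain ⟨t, _, ht⟩ := this.1 hq
    simp [hq, ← ht]
  · simp [hq, this.2 hq]

theorem sum_cells (A : Finset I) (L : ℕ) (q : I) (hq : q ∈ A) (f : (I → ℤ) → ZMod 2) :
    ∑ v ∈ cells A L, f v =
      ∑ v ∈ cells (A.erase q) L, ∑ t ∈ range L, f (update v q (2 * t + 1 : ℤ)) := by
  rw [Finset.sum_sigma']
  symm
  refine Finset.sum_bij (fun x _ => update x.1 q (2 * x.2 + 1 : ℤ)) ?_ ?_ ?_ ?_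
  · rintro ⟨v, t⟩ h
    simp only [mem_sigma, mem_range] at h
    rw [mem_cells] at h ⊢
    intro p
    by_cases hp : p = q
    · subst hp
      simp only [update_self]
      exact ⟨fun _ => ⟨t, h.2, rfl⟩, fun hh => absurd hq hh⟩
    · have := h.1 p
      simpa [hp] using this
  · rintro ⟨v, t⟩ h ⟨v', t'⟩ h' e
    simp only [mem_sigma, mem_range] at h h'
    have e1 := congrFun e q
    simp only [update_self] at e1
    have e2 : t = t' := by omega
    subst e2
    have e3 : v = v' := by
      ext p
      by_cases hp : p = q
      · subst hp
        rw [((mem_cells.1 h.1) p).2 (by simp), ((mem_cells.1 h'.1) p).2 (by simp)]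
      · have := congrFun e p
        simpa [hp] using this
    subst e3; rfl
  · intro v hv
    obtain ⟨t, ht, htv⟩ := ((mem_cells.1 hv) q).1 hq
    refine ⟨⟨update v q 0, t⟩, ?_, ?_⟩
    · simp only [mem_sigma, mem_range]
      refine ⟨?_, ht⟩
      rw [mem_cells] at hv ⊢
      intro p
      by_cases hp : p = q
      · subst hp; simp
      · simpa [hp] using hv p
    · simp [htv]
  · rintro ⟨v, t⟩ h; rfl

theorem telescope (g : ℕ → ZMod 2) (L : ℕ) :
    ∑ t ∈ range L, (g (t + 1) + g t) = g L + g 0 := by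
  induction L with
  | zero => simp [z2_add_self]
  | succ n ih => rw [Finset.sum_range_succ, ih]; linear_combination z2_add_self (g n)

theorem sum_gT (h : ℕ → (I → ℤ) → ZMod 2) (A : Finset I) (L n : ℕ) :
    ∑ v ∈ cells A L, gT h (n+1) v = ∑ q ∈ A, ∑ v ∈ cells (A.erase q) L,
      (h n (update v q (2 * L : ℤ)) * gT h n (update v q (2 * L : ℤ)) + h n v * gT h n v) := by
  have h1 : ∑ v ∈ cells A L, gT h (n+1) v = ∑ v ∈ cells A L, ∑ q ∈ A,
      ((fun w => h n w * gT h n w) (update v q (v q + 1)) +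
        (fun w => h n w * gT h n w) (update v q (v q - 1))) := by
    refine Finset.sum_congr rfl fun v hv => ?_
    simp only [gT, bd]
    rw [cells_odd hv]
  rw [h1, Finset.sum_comm]
  refine Finset.sum_congr rfl fun q hq => ?_
  rw [sum_cells A L q hq]
  refine Finset.sum_congr rfl fun v hv => ?_
  have hvq : v q = 0 := ((mem_cells.1 hv) q).2 (by simp)
  have := telescope (fun t => (fun w => h n w * gT h n w) (update v q (2 * t : ℤ))) L
  simp only [update_self, update_idem]
  rw [show h n v * gT h n v = (fun w => h n w * gT h n w) (update v q (2 * (0:ℕ) : ℤ)) by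
    simp only [Nat.cast_zero, mul_zero]
    rw [← hvq, update_eq_self]]
  rw [← this]
  refine Finset.sum_congr rfl fun t _ => ?_
  simp only
  congr 4 <;> push_cast <;> ring_nf

end Grid
end EqP

namespace EqP
open Finset Function

section Count
variable {m d : ℕ}

/-- coordinates below b -/
def Ab (b : Fin m →₀ ℕ) : Finset (Fin m × Fin d) := univ.filter (fun q => q.2.val < b q.1)

/-- reflected coordinates -/
def Bset (i : Fin m) (c : Fin d) : Finset (Fin m × Fin d) := univ.filter (fun q => q.1 = i ∧ q.2 ≤ c)

theorem fclosed_last (q : Fin m × Fin d) (L : ℤ) : FClosed {w : Fin m × Fin d → ℤ | w q = 2 * L ∧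
    ∀ i' (l : Fin d), l.val + 1 = d → w (i', l) = 0} := by
  rintro v ⟨h1, h2⟩ p hp
  have a1 : q ≠ p := by
    rintro rfl; rw [h1] at hp; exact absurd hp (by simp)
  have a2 : ∀ i' (l : Fin d), l.val + 1 = d → (i', l) ≠ p := by
    rintro i' l hl rfl; rw [h2 i' l hl] at hp; exact absurd hp (by simp)
  constructor
  · refine ⟨by rw [update_of_ne a1]; exact h1, fun i' l hl => by
      rw [update_of_ne (a2 i' l hl)]; exact h2 i' l hl⟩
  · refine ⟨by rw [update_of_ne a1]; exact h1, fun i' l hl => by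
      rw [update_of_ne (a2 i' l hl)]; exact h2 i' l hl⟩

theorem fclosed_deg (q : Fin m × Fin d) (L : ℤ) : FClosed {w : Fin m × Fin d → ℤ |
    w q = 0 ∨ w q = 2 * L} := by
  rintro v h1 p hp
  have a1 : q ≠ p := by
    rintro rfl
    rcases h1 with h1 | h1 <;> rw [h1] at hp <;> exact absurd hp (by simp)
  simp only [Set.mem_ofPred_eq, update_of_ne a1]
  exact ⟨h1, h1⟩

theorem mem_Ab (b : Fin m →₀ ℕ) (q : Fin m × Fin d) : q ∈ Ab b ↔ q.2.val < b q.1 := by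
  simp [Ab]

theorem erase_Ab (b : Fin m →₀ ℕ) (i : Fin m) (l : Fin d) (hl : l.val + 1 = b i) :
    (Ab b : Finset (Fin m × Fin d)).erase (i, l) = Ab (b - Finsupp.single i 1) := by
  ext ⟨i', l'⟩
  rw [mem_erase, mem_Ab, mem_Ab]
  simp only [Finsupp.coe_tsub, Pi.sub_apply, ne_eq, Prod.mk.injEq]
  by_cases hi : i = i'
  · subst hi
    have e1 : (Finsupp.single i 1 : Fin m →₀ ℕ) i = 1 := by simp
    simp only [Fin.ext_iff, true_and]
    rw [e1]; omega
  · have hi' : ¬ i' = i := fun e => hi e.symm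
    simp [hi, hi', Finsupp.single_apply]

theorem count_step (S : ℕ → Finset (Fin m)) (h : ℕ → (Fin m × Fin d → ℤ) → ZMod 2) (L : ℕ)
    (h1 : ∀ r w i (c l : Fin d), c < l → (w (i, c) = 0 ∨ w (i, c) = 2 * (L : ℤ)) → ∀ x,
      h r (update w (i, l) x) = h r w)
    (h2 : ∀ r w i (c : Fin d), w (i, c) = 2 * (L : ℤ) →
      (∀ i' (l : Fin d), l.val + 1 = d → w (i', l) = 0) →
      h r (refl (Bset i c) L w) = h r w + if i ∈ S r then 1 else 0)
    (n : ℕ) (b : Fin m →₀ ℕ) (hb : ∀ i, b i < d) (i : Fin m) (l : Fin d) (hl : l.val + 1 = b i) :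
    ∑ v ∈ cells ((Ab b : Finset (Fin m × Fin d)).erase (i, l)) L,
      (h n (update v (i, l) (2 * L : ℤ)) * gT h n (update v (i, l) (2 * L : ℤ)) + h n v * gT h n v)
    = if i ∈ S n then ∑ v ∈ cells (Ab (b - Finsupp.single i 1) : Finset (Fin m × Fin d)) L,
        gT h n v else 0 := by
  rw [← erase_Ab b i l hl]
  set A' := (Ab b : Finset (Fin m × Fin d)).erase (i, l) with hA'
  have hlast : ∀ v ∈ cells A' L, update v (i, l) (2 * L : ℤ) ∈
      {w : Fin m × Fin d → ℤ | w (i, l) = 2 * (L : ℤ) ∧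
        ∀ i' (l : Fin d), l.val + 1 = d → w (i', l) = 0} := by
    intro v hv
    refine ⟨by simp, ?_⟩
    intro i' l' hl'
    have hne : (i', l') ≠ (i, l) := by
      intro e
      simp only [Prod.mk.injEq] at e
      have := hb i
      rw [e.2] at hl'; omega
    rw [update_of_ne hne]
    refine ((mem_cells.1 hv) _).2 ?_
    have := hb i'
    simp [hA', Ab]
    intro _; omega
  have hmem : ∀ v ∈ cells A' L, refl (Bset i l) L (update v (i, l) (2 * L : ℤ)) ∈ cells A' L := by
    intro v hv
    rw [mem_cells] at hv ⊢
    intro p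
    by_cases hp : p = (i, l)
    · subst hp
      simp [refl, Bset, hA']
    · have hvp := hv p
      simp only [refl, update_of_ne hp]
      split_ifs with hB
      · constructor
        · intro hpA
          obtain ⟨t, ht, e⟩ := hvp.1 hpA
          refine ⟨L - 1 - t, by omega, ?_⟩
          rw [← e]
          have : ((L - 1 - t : ℕ) : ℤ) = L - 1 - t := by omega
          rw [this]; ring
        · intro hpA
          exfalso
          apply hpA
          rw [hA', Finset.mem_erase]
          refine ⟨hp, ?_⟩
          obtain ⟨p1, p2⟩ := p
          simp only [Bset, mem_filter, mem_univ, true_and] at hB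
          simp only [Ab, mem_filter, mem_univ, true_and]
          have : p2.val ≤ l.val := hB.2
          rw [hB.1]; omega
      · exact hvp
  have hinv : ∀ v ∈ cells A' L, refl (Bset i l) L (update
      (refl (Bset i l) L (update v (i, l) (2 * L : ℤ))) (i, l) (2 * L : ℤ)) = v := by
    intro v hv
    ext p
    by_cases hp : p = (i, l)
    · subst hp
      have : v (i, l) = 0 := ((mem_cells.1 hv) _).2 (by simp [hA'])
      simp [refl, Bset, this]
    · simp only [refl, update_of_ne hp]
      split_ifs <;> ring
  have key : ∑ v ∈ cells A' L,
      h n (update v (i, l) (2 * L : ℤ)) * gT h n (update v (i, l) (2 * L : ℤ)) =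
      ∑ v ∈ cells A' L, (h n v + if i ∈ S n then 1 else 0) * gT h n v := by
    refine Finset.sum_bij' (fun v _ => refl (Bset i l) L (update v (i, l) (2 * L : ℤ)))
      (fun v _ => refl (Bset i l) L (update v (i, l) (2 * L : ℤ))) hmem hmem hinv hinv ?_
    intro v hv
    have hD := hlast v hv
    rw [gT_refl (fclosed_last (i, l) (L : ℤ)) (Bset i l) L (fun r => if i ∈ S r then 1 else 0)
      (fun r w hw => h2 r w i l hw.1 hw.2) n _ hD, h2 n _ i l hD.1 hD.2]
    congr 1
    rw [add_assoc, z2_add_self, add_zero]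
  rw [Finset.sum_add_distrib, key, ← Finset.sum_add_distrib]
  split_ifs with hS
  · refine Finset.sum_congr rfl fun v _ => ?_
    linear_combination z2_add_self (h n v * gT h n v)
  · refine Finset.sum_eq_zero fun v _ => ?_
    linear_combination z2_add_self (h n v * gT h n v)

theorem count_deg (h : ℕ → (Fin m × Fin d → ℤ) → ZMod 2) (L : ℕ)
    (h1 : ∀ r w i (c l : Fin d), c < l → (w (i, c) = 0 ∨ w (i, c) = 2 * (L : ℤ)) → ∀ x,
      h r (update w (i, l) x) = h r w)
    (n : ℕ) (A : Finset (Fin m × Fin d)) (hA : A.card = n + 1) (i : Fin m) (c l : Fin d)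
    (hcl : c < l) (hc : (i, c) ∈ A) (hl : (i, l) ∈ A) :
    ∑ v ∈ cells (A.erase (i, c)) L,
      (h n (update v (i, c) (2 * L : ℤ)) * gT h n (update v (i, c) (2 * L : ℤ)) + h n v * gT h n v)
    = 0 := by
  refine Finset.sum_eq_zero fun v hv => ?_
  have hne : (i, l) ≠ (i, c) := by simp [hcl.ne']
  have hodd : Odd (v (i, l)) := by
    have : (i, l) ∈ univ.filter (fun q => Odd (v q)) := by
      rw [cells_odd hv]; simp [hl]; exact hcl.ne'
    simpa using this
  have hcard : (univ.filter (fun q => Odd (v q))).card = n := by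
    rw [cells_odd hv, Finset.card_erase_of_mem hc, hA]; rfl
  have hv0 : v (i, c) = 0 := ((mem_cells.1 hv) _).2 (by simp)
  have hD := fclosed_deg (i, c) (L : ℤ)
  have hq : ∀ r, ∀ w ∈ {w : Fin m × Fin d → ℤ | w (i, c) = 0 ∨ w (i, c) = 2 * (L : ℤ)},
      ∀ x, h r (update w (i, l) x) = h r w := fun r w hw x => h1 r w i c l hcl hw x
  rw [gT_deg_odd hD (i, l) hq n v (Or.inl hv0) hodd hcard,
    gT_deg_odd hD (i, l) hq n (update v (i, c) (2 * L : ℤ)) (Or.inr (by simp))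
      (by rwa [update_of_ne hne]) ?_]
  · simp
  · rw [filter_odd_update _ _ _ (by simp), Finset.erase_eq_of_notMem (by simp [hv0]), hcard]

theorem card_Ab (b : Fin m →₀ ℕ) (hb : ∀ i, b i < d) :
    (Ab b : Finset (Fin m × Fin d)).card = ∑ i, b i := by
  have : (Ab b : Finset (Fin m × Fin d)).card = ∑ q : Fin m × Fin d, if q.2.val < b q.1 then 1 else 0 := by
    rw [Ab, Finset.card_filter]
  rw [this, Fintype.sum_prod_type]
  refine Finset.sum_congr rfl fun i _ => ?_
  simp only
  rw [← Finset.card_filter, Fin.card_filter_val_lt]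
  exact min_eq_right (hb i).le

theorem count (S : ℕ → Finset (Fin m)) (h : ℕ → (Fin m × Fin d → ℤ) → ZMod 2) (L : ℕ)
    (h1 : ∀ r w i (c l : Fin d), c < l → (w (i, c) = 0 ∨ w (i, c) = 2 * (L : ℤ)) → ∀ x,
      h r (update w (i, l) x) = h r w)
    (h2 : ∀ r w i (c : Fin d), w (i, c) = 2 * (L : ℤ) →
      (∀ i' (l : Fin d), l.val + 1 = d → w (i', l) = 0) →
      h r (refl (Bset i c) L w) = h r w + if i ∈ S r then 1 else 0)
    (n : ℕ) : ∀ (b : Fin m →₀ ℕ), (∀ i, b i < d) → ∑ i, b i = n →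
    ∑ v ∈ cells (Ab b : Finset (Fin m × Fin d)) L, gT h n v =
      MvPolynomial.coeff b (∏ r ∈ range n, ∑ i ∈ S r, (MvPolynomial.X i : MvPolynomial (Fin m) (ZMod 2))) := by
  induction n with
  | zero =>
    intro b hb hs
    have hb0 : b = 0 := by
      ext i
      simpa using (Finset.sum_eq_zero_iff.1 hs) i (mem_univ i)
    subst hb0
    have hc : cells (Ab (0 : Fin m →₀ ℕ) : Finset (Fin m × Fin d)) L = {0} := by
      ext v
      rw [mem_cells]
      simp [Ab, funext_iff]
    rw [hc]
    simp [gT]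
  | succ n ih =>
    intro b hb hs
    rw [sum_gT, Finset.prod_range_succ, Finset.mul_sum, MvPolynomial.coeff_sum]
    simp only [MvPolynomial.coeff_mul_X']
    have hcard := card_Ab b hb
    rw [hs] at hcard
    have e1 : ∀ q ∈ (Ab b : Finset (Fin m × Fin d)), ∑ v ∈ cells ((Ab b).erase q) L,
        (h n (update v q (2 * L : ℤ)) * gT h n (update v q (2 * L : ℤ)) + h n v * gT h n v) =
        if q.2.val + 1 = b q.1 then (if q.1 ∈ S n then
          ∑ v ∈ cells (Ab (b - Finsupp.single q.1 1) : Finset (Fin m × Fin d)) L, gT h n v else 0)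
        else 0 := by
      rintro ⟨i, l⟩ hq
      split_ifs with hl hS
      · rw [count_step S h L h1 h2 n b hb i l hl, if_pos hS]
      · rw [count_step S h L h1 h2 n b hb i l hl, if_neg hS]
      · have hlb : l.val < b i := by simpa [Ab] using hq
        simp only at hl
        have hbi := hb i
        refine count_deg h L h1 n _ hcard i l ⟨l.val + 1, by omega⟩ ?_ hq ?_
        · simp [Fin.lt_def]
        · simp [Ab]; omega
    rw [Finset.sum_congr rfl e1, Ab, Finset.sum_filter, Fintype.sum_prod_type]
    rw [← Finset.sum_subset (Finset.subset_univ (S n))]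
    · refine Finset.sum_congr rfl fun i hi => ?_
      simp only [hi, if_true]
      split_ifs with hsup
      · have hbi : b i ≠ 0 := by simpa using hsup
        have hbd := hb i
        rw [Finset.sum_eq_single (⟨b i - 1, by omega⟩ : Fin d)]
        · simp only
          rw [if_pos (by omega), if_pos (by omega)]
          refine ih _ ?_ ?_
          · intro j
            have := hb j
            simp only [Finsupp.coe_tsub, Pi.sub_apply]; omega
          · have : ∑ j, b j = ∑ j, (b - Finsupp.single i 1 : Fin m →₀ ℕ) j + ∑ j, (Finsupp.single i 1 : Fin m →₀ ℕ) j := by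
              rw [← Finset.sum_add_distrib]
              refine Finset.sum_congr rfl fun j _ => ?_
              simp only [Finsupp.coe_tsub, Pi.sub_apply, Finsupp.single_apply]
              split_ifs with hij
              · subst hij; omega
              · omega
            have e2 : ∑ j, (Finsupp.single i 1 : Fin m →₀ ℕ) j = 1 := by
              simp [Finsupp.single_apply]
            rw [e2] at this
            omega
        · intro l _ hl
          rw [if_neg (c := l.val + 1 = b i)]
          · simp
          · intro e; apply hl; ext; simp; omega
        · simp
      · have hbi : b i = 0 := by simpa using hsup
        simp [hbi]
    · intro i _ hi
      simp [hi]

end Count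
end EqP

namespace EqP
open Finset Function

section BU
variable {m d : ℕ}

/-- spherical coordinates -/
noncomputable def sph (θ : Fin d → ℝ) : EuclideanSpace ℝ (Fin d) :=
  WithLp.toLp 2 (fun l => (∏ l' ∈ univ.filter (· < l), Real.sin (θ l')) * Real.cos (θ l))

theorem sph_norm (θ : Fin d → ℝ) (c : Fin d) (hc : Real.sin (θ c) = 0) : ‖sph θ‖ = 1 := by
  have h1 := Finset.prod_one_sub_ordered (univ : Finset (Fin d)) (fun l => Real.cos (θ l) ^ 2)
  have h2 : ∏ i : Fin d, (1 - Real.cos (θ i) ^ 2) = 0 := by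
    refine Finset.prod_eq_zero (mem_univ c) ?_
    rw [← Real.sin_sq, hc]; norm_num
  rw [h2] at h1
  rw [EuclideanSpace.norm_eq, Real.sqrt_eq_one]
  have h3 : ∀ l, ‖sph θ l‖ ^ 2 = Real.cos (θ l) ^ 2 * ∏ j ∈ univ.filter (· < l), (1 - Real.cos (θ j) ^ 2) := by
    intro l
    rw [Real.norm_eq_abs, sq_abs]
    simp only [sph]
    rw [mul_pow, ← Finset.prod_pow, mul_comm]
    simp only [Real.sin_sq]
  rw [Finset.sum_congr rfl (fun l _ => h3 l)]
  linarith

theorem sph_cont : Continuous (sph : (Fin d → ℝ) → EuclideanSpace ℝ (Fin d)) := by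
  unfold sph
  fun_prop

theorem sph_neg (θ : Fin d → ℝ) (c : Fin d) (hc : Real.sin (θ c) = 0) :
    sph (fun l => if l ≤ c then Real.pi - θ l else θ l) = - sph θ := by
  ext l
  simp only [sph, PiLp.neg_apply]
  have hs : ∀ l', Real.sin (if l' ≤ c then Real.pi - θ l' else θ l') = Real.sin (θ l') := by
    intro l'
    split_ifs
    · exact Real.sin_pi_sub _
    · rfl
  simp only [hs]
  by_cases hl : l ≤ c
  · rw [if_pos hl, Real.cos_pi_sub]; ring
  · have : ∏ l' ∈ univ.filter (· < l), Real.sin (θ l') = 0 :=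
      Finset.prod_eq_zero (i := c) (by simpa using hl) hc
    rw [this]; simp

theorem sph_deg (θ : Fin d → ℝ) (c l : Fin d) (hcl : c < l) (hc : Real.sin (θ c) = 0) (x : ℝ) :
    sph (update θ l x) = sph θ := by
  ext p
  simp only [sph]
  by_cases hp : c < p
  · have e1 : ∏ l' ∈ univ.filter (· < p), Real.sin (θ l') = 0 :=
      Finset.prod_eq_zero (i := c) (by simpa using hp) hc
    have e2 : ∏ l' ∈ univ.filter (· < p), Real.sin (update θ l x l') = 0 :=
      Finset.prod_eq_zero (i := c) (by simpa using hp) (by rw [update_of_ne hcl.ne, hc])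
    rw [e1, e2]
    simp
  · have hpl : p ≠ l := by rintro rfl; exact hp hcl
    rw [update_of_ne hpl]
    congr 1
    refine Finset.prod_congr rfl fun q hq => ?_
    have hq' : q < p := by simpa using hq
    have : q ≠ l := by
      rintro rfl
      exact hp (hcl.trans hq')
    rw [update_of_ne this]

/-- tie breaking sign -/
noncomputable def tau (x : EuclideanSpace ℝ (Fin d)) : ZMod 2 := by
  classical exact if 0 < toLex (x : Fin d → ℝ) then 1 else 0

theorem tau_neg (x : EuclideanSpace ℝ (Fin d)) (hx : x ≠ 0) : tau (-x) = tau x + 1 := by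
  have h0 : toLex (x : Fin d → ℝ) ≠ 0 := by
    intro h; apply hx
    ext i
    exact congrFun h i
  have hn : toLex ((-x : EuclideanSpace ℝ (Fin d)) : Fin d → ℝ) = - toLex (x : Fin d → ℝ) := rfl
  unfold tau
  rw [hn]
  rcases lt_or_gt_of_ne h0 with h | h
  · rw [if_pos (by exact neg_pos.2 h), if_neg (by exact lt_asymm h)]; rfl
  · have h' : ¬ (0 < - toLex (x : Fin d → ℝ)) := fun h' => lt_asymm h (neg_pos.1 h')
    rw [if_neg (by exact h'), if_pos (by exact h)]; rfl

/-- sign with tie breaking -/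
noncomputable def Hs (S : Finset (Fin m)) (F : (Fin m → EuclideanSpace ℝ (Fin d)) → ℝ)
    (u : Fin m → EuclideanSpace ℝ (Fin d)) : ZMod 2 :=
  if 0 < F u then 1 else if F u < 0 then 0 else ∑ i ∈ S, tau (u i)

theorem Hs_neg (S : Finset (Fin m)) (F : (Fin m → EuclideanSpace ℝ (Fin d)) → ℝ)
    (u : Fin m → EuclideanSpace ℝ (Fin d)) (i : Fin m) (hu : u i ≠ 0)
    (hF : F (update u i (- u i)) = (if i ∈ S then -1 else 1) * F u) :
    Hs S F (update u i (- u i)) = Hs S F u + if i ∈ S then 1 else 0 := by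
  unfold Hs
  rw [hF]
  by_cases hi : i ∈ S
  · simp only [hi, if_true]
    rcases lt_trichotomy (F u) 0 with h | h | h
    · rw [if_pos (by linarith), if_neg (by linarith), if_pos h]; rfl
    · rw [h]
      simp only [mul_zero, lt_irrefl, if_false]
      rw [← Finset.add_sum_erase S _ hi, ← Finset.add_sum_erase S _ hi, update_self,
        tau_neg _ hu, Finset.sum_congr rfl (g := fun j => tau (u j))]
      · ring
      · intro j hj
        rw [update_of_ne (Finset.ne_of_mem_erase hj)]
    · rw [if_neg (by linarith), if_pos (by linarith), if_pos h]; rfl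
  · simp only [hi, if_false, one_mul, add_zero]
    rw [Finset.sum_congr rfl (g := fun j => tau (u j))]
    intro j hj
    rw [update_of_ne]
    rintro rfl; exact hi hj

theorem exists_coeff (N : ℕ) (S : ℕ → Finset (Fin m))
    (hQ : (∏ r ∈ range N, ∑ i ∈ S r, (MvPolynomial.X i : MvPolynomial (Fin m) (ZMod 2))) ∉
      Ideal.span (Set.range fun i : Fin m => (MvPolynomial.X i : MvPolynomial (Fin m) (ZMod 2)) ^ d)) :
    ∃ b : Fin m →₀ ℕ, (∀ i, b i < d) ∧ ∑ i, b i = N ∧ MvPolynomial.coeff b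
      (∏ r ∈ range N, ∑ i ∈ S r, (MvPolynomial.X i : MvPolynomial (Fin m) (ZMod 2))) ≠ 0 := by
  have e : (Set.range fun i : Fin m => (MvPolynomial.X i : MvPolynomial (Fin m) (ZMod 2)) ^ d) =
      (fun s => MvPolynomial.monomial s (1 : ZMod 2)) '' (Set.range fun i : Fin m => Finsupp.single i d) := by
    rw [← Set.range_comp]
    congr 1
    ext1 i
    simp [MvPolynomial.X_pow_eq_monomial]
  rw [e, MvPolynomial.mem_ideal_span_monomial_image] at hQ
  push Not at hQ
  obtain ⟨b, hb, hb2⟩ := hQ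
  refine ⟨b, ?_, ?_, by simpa using hb⟩
  · intro i
    by_contra hcon
    refine hb2 _ ⟨i, rfl⟩ ?_
    rw [Finsupp.single_le_iff]; omega
  · have hh : (∏ r ∈ range N, ∑ i ∈ S r, (MvPolynomial.X i : MvPolynomial (Fin m) (ZMod 2))).IsHomogeneous
        (∑ r ∈ range N, 1) := by
      refine MvPolynomial.IsHomogeneous.prod _ _ _ fun r _ => ?_
      refine MvPolynomial.IsHomogeneous.sum _ _ _ fun i _ => MvPolynomial.isHomogeneous_X _ _
    have := hh (by simpa using hb)
    rw [Finsupp.weight_apply, Finsupp.sum_fintype _ _ (by simp)] at this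
    simpa using this

/-- tuple of points on the sphere from angles -/
noncomputable def Umap (x : Fin m × Fin d → ℝ) : Fin m → EuclideanSpace ℝ (Fin d) :=
  fun i => sph fun l => x (i, l)

/-- grid angles -/
noncomputable def ang (L : ℕ) (v : Fin m × Fin d → ℤ) : Fin m × Fin d → ℝ :=
  fun q => Real.pi * v q / (2 * L)

theorem ang_sin (L : ℕ) (hLpos : (0 : ℝ) < L) (v : Fin m × Fin d → ℤ) (q : Fin m × Fin d)
    (h : v q = 0 ∨ v q = 2 * (L : ℤ)) : Real.sin (ang L v q) = 0 := by
  rcases h with h | h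
  · simp [ang, h]
  · simp only [ang, h]
    push_cast
    rw [mul_div_assoc, div_self (by positivity), mul_one, Real.sin_pi]

theorem Uang_deg (L : ℕ) (hLpos : (0 : ℝ) < L) (w : Fin m × Fin d → ℤ) (i : Fin m) (c l : Fin d)
    (hcl : c < l) (hw : w (i, c) = 0 ∨ w (i, c) = 2 * (L : ℤ)) (x : ℤ) :
    Umap (ang L (update w (i, l) x)) = Umap (ang L w) := by
  funext j
  by_cases hj : j = i
  · subst hj
    have e : (fun l' => ang L (update w (j, l) x) (j, l')) =
        update (fun l' => ang L w (j, l')) l (Real.pi * x / (2 * L)) := by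
      funext l'
      by_cases hl : l' = l
      · subst hl; simp [ang]
      · have : (j, l') ≠ (j, l) := by simpa using hl
        simp only [ang, update_of_ne hl, update_of_ne this]
    change sph _ = sph _
    rw [e]
    have hs := ang_sin L hLpos w (j, c) hw
    exact sph_deg (fun l' => ang L w (j, l')) c l hcl hs _
  · change sph _ = sph _
    congr 1
    funext l'
    have : (j, l') ≠ (i, l) := by simp [hj]
    simp only [ang, update_of_ne this]

theorem Uang_refl (L : ℕ) (hLpos : (0 : ℝ) < L) (w : Fin m × Fin d → ℤ) (i : Fin m) (c : Fin d)
    (hw : w (i, c) = 2 * (L : ℤ)) :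
    Umap (ang L (refl (Bset i c) L w)) =
      update (Umap (ang L w)) i (- Umap (ang L w) i) := by
  funext j
  by_cases hj : j = i
  · subst hj
    rw [update_self]
    simp only [Umap]
    have hs := ang_sin L hLpos w (j, c) (Or.inr hw)
    rw [← sph_neg (fun l' => ang L w (j, l')) c hs]
    congr 1
    funext l'
    simp only [ang, refl, Bset, mem_filter, mem_univ, true_and]
    split_ifs with hl
    · push_cast
      field_simp
    · rfl
  · rw [update_of_ne hj]
    change sph _ = sph _
    congr 1
    funext l'
    simp [ang, refl, Bset, hj]

theorem BU_nat (hd : 0 < d) (N : ℕ) (S : ℕ → Finset (Fin m))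
    (F : ℕ → (Fin m → EuclideanSpace ℝ (Fin d)) → ℝ)
    (hF : ∀ r, ContinuousOn (F r) {u | ∀ i, ‖u i‖ = 1})
    (hE : ∀ r u i, (∀ i, ‖u i‖ = 1) → F r (update u i (- u i)) = (if i ∈ S r then -1 else 1) * F r u)
    (hQ : (∏ r ∈ range N, ∑ i ∈ S r, (MvPolynomial.X i : MvPolynomial (Fin m) (ZMod 2))) ∉
      Ideal.span (Set.range fun i : Fin m => (MvPolynomial.X i : MvPolynomial (Fin m) (ZMod 2)) ^ d)) :
    ∃ u : Fin m → EuclideanSpace ℝ (Fin d), (∀ i, ‖u i‖ = 1) ∧ ∀ r < N, F r u = 0 := by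
  obtain ⟨b, hb, hbN, hcoef⟩ := exists_coeff N S hQ
  by_contra hno
  push Not at hno
  let last : Fin d := ⟨d - 1, by omega⟩
  let K : Set (Fin m × Fin d → ℝ) := {x | (∀ q, x q ∈ Set.Icc 0 Real.pi) ∧ ∀ i, x (i, last) = 0}
  have hK : IsCompact K := by
    have h1 : IsCompact (Set.univ.pi fun _ : Fin m × Fin d => Set.Icc (0:ℝ) Real.pi) :=
      isCompact_univ_pi fun _ => isCompact_Icc
    have h2 : IsClosed {x : Fin m × Fin d → ℝ | ∀ i, x (i, last) = 0} := by
      have : {x : Fin m × Fin d → ℝ | ∀ i, x (i, last) = 0} = ⋂ i, {x | x (i, last) = 0} := by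
        ext; simp
      rw [this]
      exact isClosed_iInter fun i => isClosed_eq (continuous_apply _) continuous_const
    have h3 := h1.inter_right h2
    convert h3 using 1
    ext x
    exact and_congr_left' (by simp only [Set.mem_univ_pi])
  have : CompactSpace K := isCompact_iff_compactSpace.1 hK
  let U : (Fin m × Fin d → ℝ) → Fin m → EuclideanSpace ℝ (Fin d) := Umap
  have hU : ∀ x ∈ K, ∀ i, ‖U x i‖ = 1 := fun x hx i =>
    sph_norm _ last (by simp only [hx.2 i, Real.sin_zero])
  have hUc : Continuous U := by
    refine continuous_pi fun i => ?_
    refine sph_cont.comp ?_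
    fun_prop
  have hG : ∀ r, Continuous fun x : K => F r (U x) := by
    intro r
    have := (hF r).comp_continuous (f := fun x : K => U x) (hUc.comp continuous_subtype_val)
      (fun x => hU x x.2)
    exact this
  let c : Fin N × Bool → Set K := fun p => if p.2 then {x | 0 < F p.1 (U x)} else {x | F p.1 (U x) < 0}
  have hco : ∀ p, IsOpen (c p) := by
    rintro ⟨r, _ | _⟩
    · simpa [c] using isOpen_lt (hG r) continuous_const
    · simpa [c] using isOpen_lt continuous_const (hG r)
  have hcov : (Set.univ : Set K) ⊆ ⋃ p, c p := by
    intro x _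
    obtain ⟨r, hr, hne⟩ := hno (U x) (hU x x.2)
    rw [Set.mem_iUnion]
    rcases lt_or_gt_of_ne hne with h | h
    · exact ⟨(⟨r, hr⟩, false), by simpa [c] using h⟩
    · exact ⟨(⟨r, hr⟩, true), by simpa [c] using h⟩
  obtain ⟨δ, hδ, hleb⟩ := lebesgue_number_lemma_of_metric isCompact_univ hco hcov
  obtain ⟨L, hL⟩ := exists_nat_gt (Real.pi / (2 * δ))
  have hLpos : (0 : ℝ) < L := lt_of_le_of_lt (by positivity) hL
  have hstep : Real.pi / (2 * L) < δ := by
    rw [div_lt_iff₀ (by positivity)] at hL ⊢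
    linarith
  let A : (Fin m × Fin d → ℤ) → Fin m × Fin d → ℝ := ang L
  let h : ℕ → (Fin m × Fin d → ℤ) → ZMod 2 := fun r w => Hs (S r) (F r) (U (A w))
  have hcount := count S h L (fun r w i c l hcl hw x => by
      simp only [h, A, U]; rw [Uang_deg L hLpos w i c l hcl hw x])
    (fun r w i c hw hlast => by
      have hu : ∀ j, ‖Umap (ang L w) j‖ = 1 := fun j =>
        sph_norm _ last (ang_sin L hLpos w (j, last) (Or.inl (hlast j last (by simp [last]; omega))))
      simp only [h, A, U]
      rw [Uang_refl L hLpos w i c hw]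
      refine Hs_neg _ _ _ _ ?_ (hE r _ i hu)
      intro h0
      have := hu i
      rw [h0, norm_zero] at this
      exact zero_ne_one this) N b hb hbN
  · rw [Finset.sum_eq_zero] at hcount
    · exact hcoef hcount.symm
    intro v hv
    let D : Set (Fin m × Fin d → ℤ) := {w | ∀ q, w q = v q ∨
      (Odd (v q) ∧ Even (w q) ∧ (w q = v q + 1 ∨ w q = v q - 1))}
    have hD : FClosed D := by
      intro w hw q hq
      have hwq : w q = v q := by
        rcases hw q with e | e
        · exact e
        · exact absurd hq (by simpa using e.2.1)
      have hvq : Odd (v q) := hwq ▸ hq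
      constructor
      · intro p
        by_cases hp : p = q
        · subst hp
          right; rw [update_self, hwq]
          exact ⟨hvq, hvq.add_one, Or.inl rfl⟩
        · rw [update_of_ne hp]; exact hw p
      · intro p
        by_cases hp : p = q
        · subst hp
          right; rw [update_self, hwq]
          exact ⟨hvq, hvq.sub_odd odd_one, Or.inr rfl⟩
        · rw [update_of_ne hp]; exact hw p
    have hDK : ∀ w ∈ D, A w ∈ K := by
      intro w hw
      have hr : ∀ q, 0 ≤ w q ∧ w q ≤ 2 * L := by
        intro q
        have hq := (mem_cells.1 hv) q
        by_cases hqA : q ∈ (Ab b : Finset (Fin m × Fin d))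
        · obtain ⟨t, ht, e⟩ := hq.1 hqA
          rcases hw q with e2 | e2
          · omega
          · omega
        · have := hq.2 hqA
          rcases hw q with e2 | e2
          · omega
          · exfalso; rw [this] at e2; simp at e2
      refine ⟨fun q => ?_, fun i => ?_⟩
      · have h1 : (0:ℝ) ≤ w q := by exact_mod_cast (hr q).1
        have h2 : (w q : ℝ) ≤ 2 * L := by exact_mod_cast (hr q).2
        constructor
        · have := Real.pi_pos
          simp only [A, ang]; positivity
        · simp only [A, ang]
          rw [div_le_iff₀ (by positivity)]
          exact mul_le_mul_of_nonneg_left h2 Real.pi_pos.le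
      · have hbi := hb i
        have : v (i, last) = 0 := ((mem_cells.1 hv) _).2 (by rw [mem_Ab]; simp [last]; omega)
        have hw0 : w (i, last) = 0 := by
          rcases hw (i, last) with e | e
          · rw [e, this]
          · exfalso; rw [this] at e; simp at e
        simp [A, ang, hw0]
    have hvD : v ∈ D := fun q => Or.inl rfl
    obtain ⟨⟨r, s⟩, hrs⟩ := hleb ⟨A v, hDK v hvD⟩ (Set.mem_univ _)
    have hDball : ∀ w (hw : w ∈ D), (⟨A w, hDK w hw⟩ : K) ∈ c (r, s) := by
      intro w hw
      apply hrs
      rw [Metric.mem_ball, Subtype.dist_eq]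
      rw [dist_pi_lt_iff hδ]
      intro q
      refine lt_of_le_of_lt ?_ hstep
      rw [Real.dist_eq]
      have : |(w q : ℝ) - v q| ≤ 1 := by
        rcases hw q with e | ⟨_, _, e | e⟩ <;> rw [e] <;> simp
      have e : A w q - A v q = Real.pi / (2 * L) * (w q - v q) := by simp only [A, ang]; ring
      rw [e, abs_mul, abs_of_nonneg (by have := Real.pi_pos; positivity)]
      have := Real.pi_pos
      exact mul_le_of_le_one_right (by positivity) ‹_›
    refine gT_const hD r (if s then 1 else 0) ?_ N r.2 v hvD
    intro w hw
    have := hDball w hw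
    cases s
    · have h' : F r (U (A w)) < 0 := by simpa [c] using this
      simp only [h, Hs]
      rw [if_neg (by linarith), if_pos h']; rfl
    · have h' : 0 < F r (U (A w)) := by simpa [c] using this
      simp only [h, Hs]
      rw [if_pos h']; rfl
theorem BU (hd : 0 < d) {R : Type} [Fintype R] (S : R → Finset (Fin m))
    (F : R → (Fin m → EuclideanSpace ℝ (Fin d)) → ℝ)
    (hF : ∀ r, ContinuousOn (F r) {u | ∀ i, ‖u i‖ = 1})
    (hE : ∀ r u i, (∀ i, ‖u i‖ = 1) → F r (update u i (- u i)) = (if i ∈ S r then -1 else 1) * F r u)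
    (hQ : (∏ r, ∑ i ∈ S r, (MvPolynomial.X i : MvPolynomial (Fin m) (ZMod 2))) ∉
      Ideal.span (Set.range fun i : Fin m => (MvPolynomial.X i : MvPolynomial (Fin m) (ZMod 2)) ^ d)) :
    ∃ u : Fin m → EuclideanSpace ℝ (Fin d), (∀ i, ‖u i‖ = 1) ∧ ∀ r, F r u = 0 := by
  let e := Fintype.equivFin R
  let S' : ℕ → Finset (Fin m) := fun n => if h : n < Fintype.card R then S (e.symm ⟨n, h⟩) else ∅
  let F' : ℕ → (Fin m → EuclideanSpace ℝ (Fin d)) → ℝ := fun n =>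
    if h : n < Fintype.card R then F (e.symm ⟨n, h⟩) else fun _ => 1
  have h1 : ∀ n, ContinuousOn (F' n) {u | ∀ i, ‖u i‖ = 1} := by
    intro n
    by_cases h : n < Fintype.card R
    · simp only [F', h, dif_pos]; exact hF _
    · simp only [F', h, dif_neg, not_false_eq_true]; exact continuousOn_const
  have h2 : ∀ n u i, (∀ i, ‖u i‖ = 1) →
      F' n (update u i (- u i)) = (if i ∈ S' n then -1 else 1) * F' n u := by
    intro n u i hu
    by_cases h : n < Fintype.card R
    · simp only [F', S', h, dif_pos]; exact hE _ u i hu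
    · simp [F', S', h]
  have h3 : (∏ r ∈ range (Fintype.card R), ∑ i ∈ S' r,
      (MvPolynomial.X i : MvPolynomial (Fin m) (ZMod 2))) =
      ∏ r, ∑ i ∈ S r, (MvPolynomial.X i : MvPolynomial (Fin m) (ZMod 2)) := by
    rw [Finset.prod_range, ← e.symm.prod_comp]
    simp [S']
  obtain ⟨u, hu, hz⟩ := BU_nat hd (Fintype.card R) S' F' h1 h2 (by rw [h3]; exact hQ)
  refine ⟨u, hu, fun r => ?_⟩
  have := hz (e r) (e r).2
  simpa [F'] using this

end BU
end EqP

namespace EqP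
open Finset Function

section Meas
variable {d : ℕ}

/-- real sign function -/
noncomputable def sg (y : ℝ) : ℝ := if y < 0 then -1 else if 0 < y then 1 else 0

theorem sg_neg (y : ℝ) : sg (-y) = - sg y := by
  unfold sg
  rcases lt_trichotomy y 0 with h | h | h
  · rw [if_neg (by linarith), if_pos (by linarith), if_pos h]; simp
  · simp [h]
  · rw [if_pos (by linarith), if_neg (by linarith), if_pos h]

theorem sg_of_pos {y : ℝ} (h : 0 < y) : sg y = 1 := by
  unfold sg; rw [if_neg (by linarith), if_pos h]

theorem sg_of_neg {y : ℝ} (h : y < 0) : sg y = -1 := by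
  unfold sg; rw [if_pos h]

theorem sg_abs (y : ℝ) : |sg y| ≤ 1 := by
  unfold sg; split_ifs <;> simp

theorem sg_mono : Monotone sg := by
  intro a b hab
  unfold sg
  split_ifs <;> linarith

theorem sg_meas : Measurable sg := by
  unfold sg
  exact Measurable.ite measurableSet_Iio measurable_const
    (Measurable.ite measurableSet_Ioi measurable_const measurable_const)

theorem sg_cont {y : ℝ} (h : y ≠ 0) : ContinuousAt sg y := by
  rcases lt_or_gt_of_ne h with h | h
  · refine (continuousAt_const (y := (-1 : ℝ))).congr ?_
    filter_upwards [Iio_mem_nhds h] with z hz using (sg_of_neg hz).symm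
  · refine (continuousAt_const (y := (1 : ℝ))).congr ?_
    filter_upwards [Ioi_mem_nhds h] with z hz using (sg_of_pos hz).symm

variable (μ : Measure (EuclideanSpace ℝ (Fin d)))

/-- signed measure difference of the two sides of a hyperplane -/
noncomputable def Mf (u : EuclideanSpace ℝ (Fin d)) (t : ℝ) : ℝ :=
  ∫ x, sg (inner ℝ x u - t) ∂μ

theorem Mf_neg (u : EuclideanSpace ℝ (Fin d)) (t : ℝ) : Mf μ (-u) (-t) = - Mf μ u t := by
  unfold Mf
  rw [← integral_neg]
  congr 1; ext x
  rw [← sg_neg]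
  congr 1
  rw [inner_neg_right]; ring

theorem sgx_meas (u : EuclideanSpace ℝ (Fin d)) (t : ℝ) :
    Measurable fun x : EuclideanSpace ℝ (Fin d) => sg (inner ℝ x u - t) := by
  refine sg_meas.comp ?_
  have : Continuous fun x : EuclideanSpace ℝ (Fin d) => (inner ℝ x u : ℝ) - t := by fun_prop
  exact this.measurable

variable [IsFiniteMeasure μ]

theorem sgx_int (u : EuclideanSpace ℝ (Fin d)) (t : ℝ) :
    Integrable (fun x : EuclideanSpace ℝ (Fin d) => sg (inner ℝ x u - t)) μ :=
  Integrable.of_bound (sgx_meas u t).aestronglyMeasurable 1 (Filter.Eventually.of_forall fun x => by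
    simpa using sg_abs _)

theorem ae_ne
    (hac : ∀ (u : EuclideanSpace ℝ (Fin d)) (t : ℝ), u ≠ 0 → μ {x | (inner ℝ x u : ℝ) = t} = 0)
    (u : EuclideanSpace ℝ (Fin d)) (t : ℝ) (hu : u ≠ 0) :
    ∀ᵐ x ∂μ, (inner ℝ x u : ℝ) - t ≠ 0 := by
  rw [ae_iff]
  convert hac u t hu using 2
  ext x
  simp [sub_eq_zero]

theorem Mf_cont_t
    (hac : ∀ (u : EuclideanSpace ℝ (Fin d)) (t : ℝ), u ≠ 0 → μ {x | (inner ℝ x u : ℝ) = t} = 0)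
    (u : EuclideanSpace ℝ (Fin d)) (t : ℝ) (hu : u ≠ 0) :
    ContinuousAt (fun t => Mf μ u t) t := by
  unfold Mf
  refine continuousAt_of_dominated (bound := fun _ => 1) ?_ ?_ (integrable_const _) ?_
  · exact Filter.Eventually.of_forall fun p => (sgx_meas u p).aestronglyMeasurable
  · exact Filter.Eventually.of_forall fun p => Filter.Eventually.of_forall fun x => by
      simpa using sg_abs _
  · filter_upwards [ae_ne μ hac u t hu] with x hx
    have h1 : ContinuousAt (fun p : ℝ => (inner ℝ x u : ℝ) - p) t := by
      fun_prop
    exact ContinuousAt.comp (g := sg) (sg_cont hx) h1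

theorem Mf_cont_u
    (hac : ∀ (u : EuclideanSpace ℝ (Fin d)) (t : ℝ), u ≠ 0 → μ {x | (inner ℝ x u : ℝ) = t} = 0)
    (u : EuclideanSpace ℝ (Fin d)) (t : ℝ) (hu : u ≠ 0) :
    ContinuousAt (fun v => Mf μ v t) u := by
  unfold Mf
  refine continuousAt_of_dominated (bound := fun _ => 1) ?_ ?_ (integrable_const _) ?_
  · exact Filter.Eventually.of_forall fun p => (sgx_meas p t).aestronglyMeasurable
  · exact Filter.Eventually.of_forall fun p => Filter.Eventually.of_forall fun x => by
      simpa using sg_abs _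
  · filter_upwards [ae_ne μ hac u t hu] with x hx
    have h1 : ContinuousAt (fun p : EuclideanSpace ℝ (Fin d) => (inner ℝ x p : ℝ) - t) u := by
      fun_prop
    exact ContinuousAt.comp (g := sg) (sg_cont hx) h1

theorem Mf_anti
    (hpos : ∀ U : Set (EuclideanSpace ℝ (Fin d)), IsOpen U → U.Nonempty → 0 < μ U)
    (u : EuclideanSpace ℝ (Fin d)) (hu : u ≠ 0) : StrictAnti (Mf μ u) := by
  intro s t hst
  unfold Mf
  rw [← sub_pos, ← integral_sub (sgx_int μ u s) (sgx_int μ u t),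
    integral_pos_iff_support_of_nonneg (fun x => sub_nonneg.2 (sg_mono (by linarith)))
      ((sgx_int μ u s).sub (sgx_int μ u t))]
  have hU : IsOpen {x : EuclideanSpace ℝ (Fin d) | s < inner ℝ x u ∧ inner ℝ x u < t} := by
    have hc : Continuous fun x : EuclideanSpace ℝ (Fin d) => (inner ℝ x u : ℝ) := by fun_prop
    exact (isOpen_lt continuous_const hc).inter (isOpen_lt hc continuous_const)
  have hne : {x : EuclideanSpace ℝ (Fin d) | s < inner ℝ x u ∧ inner ℝ x u < t}.Nonempty := by
    refine ⟨((s + t) / 2 / ‖u‖ ^ 2) • u, ?_⟩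
    have hn : ‖u‖ ≠ 0 := by simpa using hu
    have : (inner ℝ (((s + t) / 2 / ‖u‖ ^ 2) • u) u : ℝ) = (s + t) / 2 := by
      rw [real_inner_smul_left, real_inner_self_eq_norm_sq]
      field_simp
    constructor <;> rw [this] <;> linarith
  refine lt_of_lt_of_le (hpos _ hU hne) (measure_mono ?_)
  rintro x ⟨h1, h2⟩
  rw [Function.mem_support, sg_of_neg (by linarith : inner ℝ x u - t < 0),
    sg_of_pos (by linarith : 0 < inner ℝ x u - s)]
  norm_num

theorem Mf_top (u : EuclideanSpace ℝ (Fin d)) :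
    Filter.Tendsto (Mf μ u) Filter.atTop (nhds (- μ.real Set.univ)) := by
  have h : - μ.real Set.univ = ∫ _, (-1 : ℝ) ∂μ := by simp
  rw [h]
  unfold Mf
  refine tendsto_integral_filter_of_dominated_convergence (fun _ => 1) ?_ ?_ (integrable_const _) ?_
  · exact Filter.Eventually.of_forall fun p => (sgx_meas u p).aestronglyMeasurable
  · exact Filter.Eventually.of_forall fun p => Filter.Eventually.of_forall fun x => by
      simpa using sg_abs _
  · refine Filter.Eventually.of_forall fun x => ?_
    refine tendsto_const_nhds.congr' ?_
    filter_upwards [Filter.eventually_gt_atTop (inner ℝ x u : ℝ)] with t ht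
    exact (sg_of_neg (by linarith)).symm

theorem Mf_bot (u : EuclideanSpace ℝ (Fin d)) :
    Filter.Tendsto (Mf μ u) Filter.atBot (nhds (μ.real Set.univ)) := by
  have h : μ.real Set.univ = ∫ _, (1 : ℝ) ∂μ := by simp
  rw [h]
  unfold Mf
  refine tendsto_integral_filter_of_dominated_convergence (fun _ => 1) ?_ ?_ (integrable_const _) ?_
  · exact Filter.Eventually.of_forall fun p => (sgx_meas u p).aestronglyMeasurable
  · exact Filter.Eventually.of_forall fun p => Filter.Eventually.of_forall fun x => by
      simpa using sg_abs _
  · refine Filter.Eventually.of_forall fun x => ?_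
    refine tendsto_const_nhds.congr' ?_
    filter_upwards [Filter.eventually_lt_atBot (inner ℝ x u : ℝ)] with t ht
    exact (sg_of_pos (by linarith)).symm

theorem Mf_surj
    (hac : ∀ (u : EuclideanSpace ℝ (Fin d)) (t : ℝ), u ≠ 0 → μ {x | (inner ℝ x u : ℝ) = t} = 0)
    (u : EuclideanSpace ℝ (Fin d)) (hu : u ≠ 0) (c : ℝ) (h1 : - μ.real Set.univ < c)
    (h2 : c < μ.real Set.univ) : ∃ t, Mf μ u t = c := by
  obtain ⟨a, ha⟩ := ((Mf_top μ u).eventually (gt_mem_nhds h1)).exists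
  obtain ⟨b, hb⟩ := ((Mf_bot μ u).eventually (lt_mem_nhds h2)).exists
  have hc : Continuous (Mf μ u) := by
    rw [continuous_iff_continuousAt]
    intro t
    exact Mf_cont_t μ hac u t hu
  exact mem_range_of_exists_le_of_exists_ge hc ⟨a, ha.le⟩ ⟨b, hb.le⟩

open Classical in
/-- the level of the hyperplane with prescribed imbalance c -/
noncomputable def lev (u : EuclideanSpace ℝ (Fin d)) (c : ℝ) : ℝ :=
  if h : ∃ t, Mf μ u t = c then h.choose else 0

theorem Mf_lev
    (hac : ∀ (u : EuclideanSpace ℝ (Fin d)) (t : ℝ), u ≠ 0 → μ {x | (inner ℝ x u : ℝ) = t} = 0)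
    (u : EuclideanSpace ℝ (Fin d)) (hu : u ≠ 0) (c : ℝ) (h1 : - μ.real Set.univ < c)
    (h2 : c < μ.real Set.univ) : Mf μ u (lev μ u c) = c := by
  have h := Mf_surj μ hac u hu c h1 h2
  unfold lev
  rw [dif_pos h]
  exact h.choose_spec

theorem lev_neg
    (hac : ∀ (u : EuclideanSpace ℝ (Fin d)) (t : ℝ), u ≠ 0 → μ {x | (inner ℝ x u : ℝ) = t} = 0)
    (hpos : ∀ U : Set (EuclideanSpace ℝ (Fin d)), IsOpen U → U.Nonempty → 0 < μ U)
    (u : EuclideanSpace ℝ (Fin d)) (hu : u ≠ 0) (c : ℝ) (h1 : - μ.real Set.univ < c)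
    (h2 : c < μ.real Set.univ) : lev μ (-u) (-c) = - lev μ u c := by
  have hu' : -u ≠ 0 := by simpa using hu
  apply (Mf_anti μ hpos (-u) hu').injective
  rw [Mf_lev μ hac (-u) hu' (-c) (by linarith) (by linarith), Mf_neg, Mf_lev μ hac u hu c h1 h2]

theorem lev_lt
    (hac : ∀ (u : EuclideanSpace ℝ (Fin d)) (t : ℝ), u ≠ 0 → μ {x | (inner ℝ x u : ℝ) = t} = 0)
    (hpos : ∀ U : Set (EuclideanSpace ℝ (Fin d)), IsOpen U → U.Nonempty → 0 < μ U)
    (u : EuclideanSpace ℝ (Fin d)) (hu : u ≠ 0) (c c' : ℝ) (h1 : - μ.real Set.univ < c)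
    (h2 : c < c') (h3 : c' < μ.real Set.univ) : lev μ u c' < lev μ u c := by
  rw [← (Mf_anti μ hpos u hu).lt_iff_gt, Mf_lev μ hac u hu c h1 (by linarith),
    Mf_lev μ hac u hu c' (by linarith) h3]
  exact h2

theorem lev_cont
    (hac : ∀ (u : EuclideanSpace ℝ (Fin d)) (t : ℝ), u ≠ 0 → μ {x | (inner ℝ x u : ℝ) = t} = 0)
    (hpos : ∀ U : Set (EuclideanSpace ℝ (Fin d)), IsOpen U → U.Nonempty → 0 < μ U)
    (u : EuclideanSpace ℝ (Fin d)) (hu : u ≠ 0) (c : ℝ) (h1 : - μ.real Set.univ < c)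
    (h2 : c < μ.real Set.univ) : ContinuousAt (fun u => lev μ u c) u := by
  rw [Metric.continuousAt_iff']
  intro ε hε
  have hcu : ∀ t, ContinuousAt (fun v => Mf μ v t) u := by
    intro t
    exact Mf_cont_u μ hac u t hu
  have ha := Mf_anti μ hpos u hu
  have hM := Mf_lev μ hac u hu c h1 h2
  have e1 : c < Mf μ u (lev μ u c - ε) := by
    have := ha (show lev μ u c - ε < lev μ u c by linarith)
    rwa [hM] at this
  have e2 : Mf μ u (lev μ u c + ε) < c := by
    have := ha (show lev μ u c < lev μ u c + ε by linarith)
    rwa [hM] at this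
  filter_upwards [(hcu (lev μ u c - ε)).eventually (lt_mem_nhds e1),
    (hcu (lev μ u c + ε)).eventually (gt_mem_nhds e2), isOpen_ne.mem_nhds hu] with v hv1 hv2 hv3
  have hMv := Mf_lev μ hac v hv3 c h1 h2
  have hav := Mf_anti μ hpos v hv3
  have hv1' := hav.lt_iff_gt.1 (hMv.trans_lt hv1)
  have hv2' := hav.lt_iff_gt.1 (hv2.trans_eq hMv.symm)
  rw [Real.dist_eq, abs_lt]
  constructor <;> linarith

theorem sglev_cont
    (hac : ∀ (u : EuclideanSpace ℝ (Fin d)) (t : ℝ), u ≠ 0 → μ {x | (inner ℝ x u : ℝ) = t} = 0)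
    (hpos : ∀ U : Set (EuclideanSpace ℝ (Fin d)), IsOpen U → U.Nonempty → 0 < μ U)
    (u : EuclideanSpace ℝ (Fin d)) (hu : u ≠ 0) (c : ℝ) (h1 : - μ.real Set.univ < c)
    (h2 : c < μ.real Set.univ) (x : EuclideanSpace ℝ (Fin d)) (hx : (inner ℝ x u : ℝ) - lev μ u c ≠ 0) :
    ContinuousAt (fun v => sg (inner ℝ x v - lev μ v c)) u := by
  have h3 : ContinuousAt (fun v => (inner ℝ x v : ℝ) - lev μ v c) u := by
    have h4 : ContinuousAt (fun v : EuclideanSpace ℝ (Fin d) => (inner ℝ x v : ℝ)) u := by fun_prop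
    exact h4.sub (lev_cont μ hac hpos u hu c h1 h2)
  exact ContinuousAt.comp (g := sg) (sg_cont hx) h3

end Meas
end EqP

namespace EqP
open Finset Function

section Eq
set_option linter.unusedSectionVars false
variable {d : ℕ}

/-- hypotheses on the measure that are used -/
structure Good (μ : Measure (EuclideanSpace ℝ (Fin d))) : Prop where
  hac : ∀ (u : EuclideanSpace ℝ (Fin d)) (t : ℝ), u ≠ 0 → μ {x | (inner ℝ x u : ℝ) = t} = 0
  hpos : ∀ U : Set (EuclideanSpace ℝ (Fin d)), IsOpen U → U.Nonempty → 0 < μ U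

variable (μ : Measure (EuclideanSpace ℝ (Fin d))) [IsFiniteMeasure μ]

/-- imbalance constants -/
noncomputable def cc (k i : ℕ) : ℝ := μ.real Set.univ * (1 - 2 * i / (2 * k + 1))

theorem Wpos (hg : Good μ) : 0 < μ.real Set.univ := by
  have := hg.hpos Set.univ isOpen_univ Set.univ_nonempty
  exact ENNReal.toReal_pos this.ne' (measure_ne_top _ _)

theorem cc_anti (hg : Good μ) (k : ℕ) {i j : ℕ} (h : i < j) : cc μ k j < cc μ k i := by
  unfold cc
  have h' : (i : ℝ) < j := by exact_mod_cast h
  have : (0 : ℝ) < 2 * k + 1 := by positivity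
  refine mul_lt_mul_of_pos_left ?_ (Wpos μ hg)
  have : 2 * (i : ℝ) / (2 * k + 1) < 2 * j / (2 * k + 1) := by gcongr
  linarith

theorem cc_zero (k : ℕ) : cc μ k 0 = μ.real Set.univ := by simp [cc]

theorem cc_end (k : ℕ) : cc μ k (2 * k + 1) = - μ.real Set.univ := by
  unfold cc
  have : (0 : ℝ) < 2 * k + 1 := by positivity
  push_cast
  field_simp
  ring

theorem cc_symm (k i : ℕ) (hi : i ≤ 2 * k + 1) : cc μ k (2 * k + 1 - i) = - cc μ k i := by
  unfold cc
  have : (0 : ℝ) < 2 * k + 1 := by positivity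
  rw [Nat.cast_sub hi]
  push_cast
  field_simp
  ring

theorem cc_lt (hg : Good μ) (k i : ℕ) (hi : 1 ≤ i) : cc μ k i < μ.real Set.univ := by
  rw [← cc_zero μ k]; exact cc_anti μ hg k hi

theorem cc_gt (hg : Good μ) (k i : ℕ) (hi : i < 2 * k + 1) : - μ.real Set.univ < cc μ k i := by
  rw [← cc_end μ k]; exact cc_anti μ hg k hi

/-- sign with respect to the i-th parallel hyperplane -/
noncomputable def th (k i : ℕ) (u x : EuclideanSpace ℝ (Fin d)) : ℝ :=
  if i = 0 then 1 else if 2 * k + 1 ≤ i then -1 else sg (inner ℝ x u - lev μ u (cc μ k i))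

theorem th_meas (k i : ℕ) (u : EuclideanSpace ℝ (Fin d)) : Measurable (th μ k i u) := by
  unfold th
  split_ifs
  · exact measurable_const
  · exact measurable_const
  · exact sgx_meas _ _

theorem th_abs (k i : ℕ) (u x : EuclideanSpace ℝ (Fin d)) : |th μ k i u x| ≤ 1 := by
  unfold th
  split_ifs
  · simp
  · simp
  · exact sg_abs _

theorem th_neg (hg : Good μ) (k i : ℕ) (u x : EuclideanSpace ℝ (Fin d)) (hu : u ≠ 0)
    (hi : i ≤ 2 * k + 1) : th μ k (2 * k + 1 - i) (-u) x = - th μ k i u x := by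
  unfold th
  by_cases h0 : i = 0
  · subst h0
    simp
  by_cases h1 : 2 * k + 1 ≤ i
  · have : i = 2 * k + 1 := le_antisymm hi h1
    subst this
    simp
  rw [if_neg (by omega), if_neg (by omega), if_neg h0, if_neg h1, cc_symm μ k i hi,
    lev_neg μ hg.hac hg.hpos u hu _ (cc_gt μ hg k i (by omega)) (cc_lt μ hg k i (by omega)),
    inner_neg_right, ← sg_neg]
  congr 1; ring

theorem th_cont (hg : Good μ) (k i : ℕ) (u : EuclideanSpace ℝ (Fin d)) (hu : u ≠ 0) :
    ∀ᵐ x ∂μ, ContinuousAt (fun v => th μ k i v x) u := by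
  unfold th
  by_cases h0 : i = 0
  · simp only [h0, if_true]
    exact Filter.Eventually.of_forall fun x => continuousAt_const
  by_cases h1 : 2 * k + 1 ≤ i
  · simp only [h0, h1, if_true, if_false]
    exact Filter.Eventually.of_forall fun x => continuousAt_const
  simp only [h0, h1, if_false]
  filter_upwards [ae_ne μ hg.hac u (lev μ u (cc μ k i)) hu] with x hx
  exact sglev_cont μ hg.hac hg.hpos u hu _ (cc_gt μ hg k i (by omega)) (cc_lt μ hg k i (by omega))
    x hx

theorem th_int (k i : ℕ) (u : EuclideanSpace ℝ (Fin d)) : Integrable (th μ k i u) μ :=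
  Integrable.of_bound (th_meas μ k i u).aestronglyMeasurable 1 (Filter.Eventually.of_forall fun x => by
    simpa using th_abs μ k i u x)

theorem th_integral (hg : Good μ) (k i : ℕ) (u : EuclideanSpace ℝ (Fin d)) (hu : u ≠ 0)
    (hi : i ≤ 2 * k + 1) : ∫ x, th μ k i u x ∂μ = cc μ k i := by
  unfold th
  by_cases h0 : i = 0
  · subst h0
    simp [cc_zero]
  by_cases h1 : 2 * k + 1 ≤ i
  · have : i = 2 * k + 1 := le_antisymm hi h1
    subst this
    simp [cc_end]
  simp only [h0, h1, if_false]
  exact Mf_lev μ hg.hac u hu _ (cc_gt μ hg k i (by omega)) (cc_lt μ hg k i (by omega))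

/-- a.e. the indicator function of the i-th slab -/
noncomputable def ind (k i : ℕ) (u x : EuclideanSpace ℝ (Fin d)) : ℝ :=
  (th μ k i u x - th μ k (i + 1) u x) / 2

theorem ind_abs (k i : ℕ) (u x : EuclideanSpace ℝ (Fin d)) : |ind μ k i u x| ≤ 1 := by
  have h1 := abs_le.1 (th_abs μ k i u x)
  have h2 := abs_le.1 (th_abs μ k (i+1) u x)
  unfold ind
  rw [abs_le]
  constructor <;> linarith [h1.1, h1.2, h2.1, h2.2]

theorem ind_meas (k i : ℕ) (u : EuclideanSpace ℝ (Fin d)) : Measurable (ind μ k i u) := by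
  unfold ind
  exact ((th_meas μ k i u).sub (th_meas μ k (i+1) u)).div_const 2

theorem ind_neg (hg : Good μ) (k i : ℕ) (u x : EuclideanSpace ℝ (Fin d)) (hu : u ≠ 0)
    (hi : i ≤ 2 * k) : ind μ k i (-u) x = ind μ k (2 * k - i) u x := by
  have h1 := th_neg μ hg k (2 * k + 1 - i) u x hu (by omega)
  have h2 := th_neg μ hg k (2 * k - i) u x hu (by omega)
  rw [show 2 * k + 1 - (2 * k + 1 - i) = i by omega] at h1
  rw [show 2 * k + 1 - (2 * k - i) = i + 1 by omega] at h2
  unfold ind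
  rw [h1, h2, show 2 * k - i + 1 = 2 * k + 1 - i by omega]
  ring

theorem ind_cont (hg : Good μ) (k i : ℕ) (u : EuclideanSpace ℝ (Fin d)) (hu : u ≠ 0) :
    ∀ᵐ x ∂μ, ContinuousAt (fun v => ind μ k i v x) u := by
  filter_upwards [th_cont μ hg k i u hu, th_cont μ hg k (i+1) u hu] with x h1 h2
  unfold ind
  exact (h1.sub h2).div_const 2

theorem ind_integral (hg : Good μ) (k i : ℕ) (u : EuclideanSpace ℝ (Fin d)) (hu : u ≠ 0)
    (hi : i ≤ 2 * k) : ∫ x, ind μ k i u x ∂μ = μ.real Set.univ / (2 * k + 1) := by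
  unfold ind
  rw [integral_div, integral_sub (th_int μ k i u) (th_int μ k (i+1) u),
    th_integral μ hg k i u hu (by omega), th_integral μ hg k (i+1) u hu (by omega)]
  unfold cc
  have : (0 : ℝ) < 2 * k + 1 := by positivity
  push_cast
  field_simp
  ring

theorem ind_sum (k : ℕ) (u x : EuclideanSpace ℝ (Fin d)) :
    ∑ i ∈ range (2 * k + 1), ind μ k i u x = 1 := by
  unfold ind
  rw [← Finset.sum_div, Finset.sum_range_sub']
  simp [th]

variable {m : ℕ}

/-- product of signs with respect to the median hyperplanes -/
noncomputable def pr (S : Finset (Fin m)) (u : Fin m → EuclideanSpace ℝ (Fin d))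
    (x : EuclideanSpace ℝ (Fin d)) : ℝ :=
  ∏ j ∈ S, sg (inner ℝ x (u j) - lev μ (u j) 0)

theorem pr_abs (S : Finset (Fin m)) (u : Fin m → EuclideanSpace ℝ (Fin d))
    (x : EuclideanSpace ℝ (Fin d)) : |pr μ S u x| ≤ 1 := by
  unfold pr
  rw [Finset.abs_prod]
  exact Finset.prod_le_one (fun _ _ => abs_nonneg _) (fun _ _ => sg_abs _)

theorem pr_meas (S : Finset (Fin m)) (u : Fin m → EuclideanSpace ℝ (Fin d)) :
    Measurable (pr μ S u) := by
  unfold pr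
  exact Finset.measurable_prod _ fun j _ => sgx_meas _ _

theorem lev0_neg (hg : Good μ) (u : EuclideanSpace ℝ (Fin d)) (hu : u ≠ 0) :
    lev μ (-u) 0 = - lev μ u 0 := by
  have := lev_neg μ hg.hac hg.hpos u hu 0 (by linarith [Wpos μ hg]) (by linarith [Wpos μ hg])
  rwa [neg_zero] at this

theorem pr_update (hg : Good μ) (S : Finset (Fin m)) (u : Fin m → EuclideanSpace ℝ (Fin d))
    (x : EuclideanSpace ℝ (Fin d)) (j : Fin m) (hu : u j ≠ 0) :
    pr μ S (update u j (-u j)) x = (if j ∈ S then -1 else 1) * pr μ S u x := by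
  unfold pr
  have hne : ∀ l ∈ S.erase j, sg (inner ℝ x (update u j (-u j) l) - lev μ (update u j (-u j) l) 0) =
      sg (inner ℝ x (u l) - lev μ (u l) 0) := by
    intro l hl
    rw [update_of_ne (Finset.ne_of_mem_erase hl)]
  split_ifs with h
  · rw [← Finset.mul_prod_erase S _ h, ← Finset.mul_prod_erase S
      (fun j => sg (inner ℝ x (u j) - lev μ (u j) 0)) h, Finset.prod_congr rfl hne, update_self,
      lev0_neg μ hg _ hu, inner_neg_right, ← mul_assoc]
    congr 1
    rw [neg_one_mul, ← sg_neg]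
    congr 1; ring
  · rw [Finset.erase_eq_of_notMem h] at hne
    rw [Finset.prod_congr rfl hne, one_mul]

theorem pr_cont (hg : Good μ) (S : Finset (Fin m)) (u : Fin m → EuclideanSpace ℝ (Fin d))
    (hu : ∀ j, u j ≠ 0) :
    ∀ᵐ x ∂μ, ContinuousAt (fun v : Fin m → EuclideanSpace ℝ (Fin d) => pr μ S v x) u := by
  have h : ∀ᵐ x ∂μ, ∀ j : Fin m, (inner ℝ x (u j) : ℝ) - lev μ (u j) 0 ≠ 0 :=
    ae_all_iff.2 fun j => ae_ne μ hg.hac (u j) _ (hu j)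
  filter_upwards [h] with x hx
  unfold pr
  refine tendsto_finsetProd _ fun j _ => ?_
  have h1 := sglev_cont μ hg.hac hg.hpos (u j) (hu j) 0 (by linarith [Wpos μ hg])
    (by linarith [Wpos μ hg]) x (hx j)
  have h2 : Filter.Tendsto (fun v : Fin m → EuclideanSpace ℝ (Fin d) => v j) (nhds u) (nhds (u j)) :=
    (continuous_apply j).tendsto u
  exact Filter.Tendsto.comp (y := nhds (u j)) h1 h2

/-- the correlation integrals -/
noncomputable def Ei (z : Fin m) (k i : ℕ) (S : Finset (Fin m))
    (u : Fin m → EuclideanSpace ℝ (Fin d)) : ℝ :=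
  ∫ x, ind μ k i (u z) x * pr μ S u x ∂μ

theorem Ei_meas (z : Fin m) (k i : ℕ) (S : Finset (Fin m))
    (u : Fin m → EuclideanSpace ℝ (Fin d)) : Measurable fun x => ind μ k i (u z) x * pr μ S u x :=
  (ind_meas μ k i _).mul (pr_meas μ S u)

theorem Ei_abs (z : Fin m) (k i : ℕ) (S : Finset (Fin m))
    (u : Fin m → EuclideanSpace ℝ (Fin d)) (x : EuclideanSpace ℝ (Fin d)) :
    |ind μ k i (u z) x * pr μ S u x| ≤ 1 := by
  rw [abs_mul]
  exact mul_le_one₀ (ind_abs μ k i _ x) (abs_nonneg _) (pr_abs μ S u x)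

theorem Ei_int (z : Fin m) (k i : ℕ) (S : Finset (Fin m))
    (u : Fin m → EuclideanSpace ℝ (Fin d)) :
    Integrable (fun x => ind μ k i (u z) x * pr μ S u x) μ :=
  Integrable.of_bound (Ei_meas μ z k i S u).aestronglyMeasurable 1
    (Filter.Eventually.of_forall fun x => by simpa only [Real.norm_eq_abs] using Ei_abs μ z k i S u x)

theorem Ei_cont (hg : Good μ) (z : Fin m) (k i : ℕ) (S : Finset (Fin m))
    (u : Fin m → EuclideanSpace ℝ (Fin d)) (hu : ∀ j, u j ≠ 0) :
    ContinuousAt (Ei μ z k i S) u := by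
  unfold Ei
  refine continuousAt_of_dominated (bound := fun _ => 1) ?_ ?_ (integrable_const _) ?_
  · exact Filter.Eventually.of_forall fun v => (Ei_meas μ z k i S v).aestronglyMeasurable
  · exact Filter.Eventually.of_forall fun v => Filter.Eventually.of_forall fun x => by
      simpa only [Real.norm_eq_abs] using Ei_abs μ z k i S v x
  · filter_upwards [ind_cont μ hg k i (u z) (hu z), pr_cont μ hg S u hu] with x h1 h2
    have h3 : Filter.Tendsto (fun v : Fin m → EuclideanSpace ℝ (Fin d) => v z) (nhds u)
      (nhds (u z)) := (continuous_apply z).tendsto u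
    have h4 : ContinuousAt (fun v : Fin m → EuclideanSpace ℝ (Fin d) => ind μ k i (v z) x) u :=
      Filter.Tendsto.comp (y := nhds (u z)) h1 h3
    exact h4.mul h2

theorem Ei_update_ne (hg : Good μ) (z : Fin m) (k i : ℕ) (S : Finset (Fin m))
    (u : Fin m → EuclideanSpace ℝ (Fin d)) (j : Fin m) (hj : j ≠ z) (hu : u j ≠ 0) :
    Ei μ z k i S (update u j (-u j)) = (if j ∈ S then -1 else 1) * Ei μ z k i S u := by
  unfold Ei
  rw [← integral_const_mul]
  congr 1; ext x
  rw [update_of_ne hj.symm, pr_update μ hg S u x j hu]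
  ring

theorem Ei_update_z (hg : Good μ) (z : Fin m) (k i : ℕ) (hi : i ≤ 2 * k) (S : Finset (Fin m))
    (hz : z ∉ S) (u : Fin m → EuclideanSpace ℝ (Fin d)) (hu : u z ≠ 0) :
    Ei μ z k i S (update u z (-u z)) = Ei μ z k (2 * k - i) S u := by
  unfold Ei
  congr 1; ext x
  rw [update_self, pr_update μ hg S u x z hu, if_neg hz, one_mul, ind_neg μ hg k i _ x hu hi]

theorem Ei_sum (z : Fin m) (k : ℕ) (S : Finset (Fin m))
    (u : Fin m → EuclideanSpace ℝ (Fin d)) :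
    ∑ i ∈ range (2 * k + 1), Ei μ z k i S u = ∫ x, pr μ S u x ∂μ := by
  unfold Ei
  rw [← integral_finsetSum _ fun i _ => Ei_int μ z k i S u]
  congr 1; ext x
  rw [← Finset.sum_mul, ind_sum, one_mul]

theorem pr_single (hg : Good μ) (j : Fin m)
    (u : Fin m → EuclideanSpace ℝ (Fin d)) (hu : u j ≠ 0) : ∫ x, pr μ {j} u x ∂μ = 0 := by
  unfold pr
  simp only [Finset.prod_singleton]
  exact Mf_lev μ hg.hac (u j) hu 0 (by linarith [Wpos μ hg]) (by linarith [Wpos μ hg])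

end Eq
end EqP

namespace EqP
open Finset Function

section Zero
variable {d m : ℕ} (μ : Measure (EuclideanSpace ℝ (Fin d))) [IsFiniteMeasure μ]

/-- test function attached to a subset and a pair of symmetric slabs -/
noncomputable def Tf (z : Fin m) (k a : ℕ) (S : Finset (Fin m))
    (u : Fin m → EuclideanSpace ℝ (Fin d)) : ℝ :=
  Ei μ z k a (S.erase z) u + (if z ∈ S then -1 else 1) * Ei μ z k (2 * k - a) (S.erase z) u

theorem Tf_cont (hg : Good μ) (z : Fin m) (k i : ℕ) (S : Finset (Fin m))
    (u : Fin m → EuclideanSpace ℝ (Fin d)) (hu : ∀ j, u j ≠ 0) :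
    ContinuousAt (Tf μ z k i S) u :=
  (Ei_cont μ hg z k i _ u hu).add (continuousAt_const.mul (Ei_cont μ hg z k _ _ u hu))

theorem Tf_update (hg : Good μ) (z : Fin m) (k a : ℕ) (ha : a ≤ 2 * k) (S : Finset (Fin m))
    (u : Fin m → EuclideanSpace ℝ (Fin d)) (hu : ∀ j, u j ≠ 0) (j : Fin m) :
    Tf μ z k a S (update u j (-u j)) = (if j ∈ S then -1 else 1) * Tf μ z k a S u := by
  unfold Tf
  by_cases hj : j = z
  · subst hj
    rw [Ei_update_z μ hg j k a ha _ (by simp) u (hu j),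
      Ei_update_z μ hg j k (2 * k - a) (by omega) _ (by simp) u (hu j),
      show 2 * k - (2 * k - a) = a by omega]
    split_ifs <;> ring
  · rw [Ei_update_ne μ hg z k a _ u j hj (hu j), Ei_update_ne μ hg z k _ _ u j hj (hu j)]
    have : j ∈ S.erase z ↔ j ∈ S := by simp [hj]
    simp only [this]
    ring

theorem prod_R {M : Type} [CommMonoid M] (z : Fin m) (k : ℕ) (g : Finset (Fin m) → M) :
    (∏ r : (({i : Fin m // i ≠ z} × Fin k) ⊕ {S : Finset (Fin m) // 2 ≤ S.card ∧ z ∉ S}) ⊕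
      ({S : Finset (Fin m) // 2 ≤ S.card} × Fin k),
      g (Sum.elim (Sum.elim (fun p => {p.1.1}) (fun S => S.1)) (fun p => p.1.1) r)) =
    (∏ i ∈ univ.filter (fun i : Fin m => i ≠ z), g {i} ^ k) *
      (∏ S ∈ univ.filter (fun S : Finset (Fin m) => 2 ≤ S.card ∧ z ∉ S), g S) *
      (∏ S ∈ univ.filter (fun S : Finset (Fin m) => 2 ≤ S.card), g S) ^ k := by
  rw [Fintype.prod_sum_type, Fintype.prod_sum_type, Fintype.prod_prod_type, Fintype.prod_prod_type]
  simp only [Sum.elim_inl, Sum.elim_inr, Finset.prod_const, Finset.card_univ, Fintype.card_fin]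
  rw [← Finset.prod_pow]
  congr 1
  · congr 1
    · exact (Finset.prod_subtype _ (by simp) (fun i => g {i} ^ k)).symm
    · exact (Finset.prod_subtype _ (by simp) g).symm
  · exact (Finset.prod_subtype _ (by simp) (fun S => g S ^ k)).symm

theorem exists_zero (hg : Good μ) (hd : 0 < d) (z : Fin m) (k : ℕ)
    (hQ : (∏ i ∈ univ.filter (fun i : Fin m => i ≠ z),
            (MvPolynomial.X i : MvPolynomial (Fin m) (ZMod 2)) ^ k) *
          (∏ S ∈ univ.filter
              (fun S : Finset (Fin m) => 2 ≤ S.card ∧ z ∉ S),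
            ∑ i ∈ S, MvPolynomial.X i) *
          (∏ S ∈ univ.filter (fun S : Finset (Fin m) => 2 ≤ S.card),
            ∑ i ∈ S, MvPolynomial.X i) ^ k ∉
      Ideal.span (Set.range fun i : Fin m =>
        (MvPolynomial.X i : MvPolynomial (Fin m) (ZMod 2)) ^ d)) :
    ∃ u : Fin m → EuclideanSpace ℝ (Fin d), (∀ i, ‖u i‖ = 1) ∧
      ∀ S : Finset (Fin m), S.Nonempty → z ∉ S → ∀ i ≤ 2 * k, Ei μ z k i S u = 0 := by
  let R : Type := (({i : Fin m // i ≠ z} × Fin k) ⊕ {S : Finset (Fin m) // 2 ≤ S.card ∧ z ∉ S}) ⊕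
    ({S : Finset (Fin m) // 2 ≤ S.card} × Fin k)
  let SS : R → Finset (Fin m) :=
    Sum.elim (Sum.elim (fun p => {p.1.1}) (fun S => S.1)) (fun p => p.1.1)
  let F : R → (Fin m → EuclideanSpace ℝ (Fin d)) → ℝ :=
    Sum.elim (Sum.elim (fun p => Tf μ z k p.2 {p.1.1}) (fun S => Ei μ z k k S.1))
      (fun p => Tf μ z k p.2 p.1.1)
  have hne : ∀ u : Fin m → EuclideanSpace ℝ (Fin d), (∀ i, ‖u i‖ = 1) → ∀ i, u i ≠ 0 := by
    intro u hu i h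
    have := hu i
    rw [h, norm_zero] at this
    exact zero_ne_one this
  have hF : ∀ r, ContinuousOn (F r) {u | ∀ i, ‖u i‖ = 1} := by
    intro r u hu
    refine ContinuousAt.continuousWithinAt ?_
    rcases r with (⟨p, a⟩ | S) | ⟨S, a⟩
    · exact Tf_cont μ hg z k a {p.1} u (hne u hu)
    · exact Ei_cont μ hg z k k S.1 u (hne u hu)
    · exact Tf_cont μ hg z k a S.1 u (hne u hu)
  have hE : ∀ r (u : Fin m → EuclideanSpace ℝ (Fin d)) i, (∀ i, ‖u i‖ = 1) →
      F r (update u i (- u i)) = (if i ∈ SS r then -1 else 1) * F r u := by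
    intro r u j hu
    rcases r with (⟨p, a⟩ | S) | ⟨S, a⟩
    · exact Tf_update μ hg z k a (by have := a.2; omega) {p.1} u (hne u hu) j
    · change Ei μ z k k S.1 _ = (if j ∈ S.1 then -1 else 1) * Ei μ z k k S.1 u
      by_cases hj : j = z
      · subst hj
        rw [Ei_update_z μ hg j k k (by omega) S.1 S.2.2 u (hne u hu j), if_neg S.2.2, one_mul,
          show 2 * k - k = k by omega]
      · exact Ei_update_ne μ hg z k k S.1 u j hj (hne u hu j)
    · exact Tf_update μ hg z k a (by have := a.2; omega) S.1 u (hne u hu) j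
  have hQ' : (∏ r, ∑ i ∈ SS r, (MvPolynomial.X i : MvPolynomial (Fin m) (ZMod 2))) ∉
      Ideal.span (Set.range fun i : Fin m =>
        (MvPolynomial.X i : MvPolynomial (Fin m) (ZMod 2)) ^ d) := by
    have h := prod_R z k (fun S : Finset (Fin m) => ∑ i ∈ S,
      (MvPolynomial.X i : MvPolynomial (Fin m) (ZMod 2)))
    simp only [Finset.sum_singleton] at h
    rw [← h] at hQ
    exact hQ
  obtain ⟨u, hu, hz⟩ := BU hd SS F hF hE hQ'
  refine ⟨u, hu, ?_⟩
  intro S hS hzS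
  have hT : ∀ a < k, Tf μ z k a S u = 0 := by
    intro a ha
    by_cases hc : 2 ≤ S.card
    · exact hz (Sum.inr (⟨S, hc⟩, ⟨a, ha⟩))
    · have : S.card = 1 := by have := hS.card_pos; omega
      obtain ⟨j, rfl⟩ := Finset.card_eq_one.1 this
      have hj : j ≠ z := by rintro rfl; simp at hzS
      exact hz (Sum.inl (Sum.inl (⟨j, hj⟩, ⟨a, ha⟩)))
  have hT' : ∀ a < k, Tf μ z k a (insert z S) u = 0 := by
    intro a ha
    have hc : 2 ≤ (insert z S).card := by
      rw [Finset.card_insert_of_notMem hzS]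
      have := hS.card_pos; omega
    exact hz (Sum.inr (⟨insert z S, hc⟩, ⟨a, ha⟩))
  have hlow : ∀ a < k, Ei μ z k a S u = 0 ∧ Ei μ z k (2 * k - a) S u = 0 := by
    intro a ha
    have h1 := hT a ha
    have h2 := hT' a ha
    unfold Tf at h1 h2
    rw [Finset.erase_eq_of_notMem hzS, if_neg hzS] at h1
    rw [Finset.erase_insert hzS, if_pos (Finset.mem_insert_self _ _)] at h2
    constructor <;> linarith
  have hoff : ∀ i ≤ 2 * k, i ≠ k → Ei μ z k i S u = 0 := by
    intro i hi hik
    rcases lt_or_gt_of_ne hik with h | h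
    · exact (hlow i h).1
    · have := (hlow (2 * k - i) (by omega)).2
      rwa [show 2 * k - (2 * k - i) = i by omega] at this
  have hmid : Ei μ z k k S u = 0 := by
    by_cases hc : 2 ≤ S.card
    · exact hz (Sum.inl (Sum.inr ⟨S, hc, hzS⟩))
    · have : S.card = 1 := by have := hS.card_pos; omega
      obtain ⟨j, rfl⟩ := Finset.card_eq_one.1 this
      have h1 := Ei_sum μ z k {j} u
      rw [pr_single μ hg j u (hne u hu j), Finset.sum_eq_single k] at h1
      · exact h1
      · intro b hb hbk
        exact hoff b (by have := Finset.mem_range.1 hb; omega) hbk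
      · intro h
        exact absurd (Finset.mem_range.2 (by omega)) h
  intro i hi
  by_cases h : i = k
  · rw [h]; exact hmid
  · exact hoff i hi h

end Zero
end EqP

namespace EqP
open Finset Function

section Box
variable {d m : ℕ} (μ : Measure (EuclideanSpace ℝ (Fin d))) [IsFiniteMeasure μ]

theorem slab_meas (u : EuclideanSpace ℝ (Fin d)) (t : ℕ → ℝ) (n i : ℕ) :
    MeasurableSet (slab u t n i) := by
  have hc : Continuous fun x : EuclideanSpace ℝ (Fin d) => (inner ℝ x u : ℝ) := by fun_prop
  unfold slab
  refine MeasurableSet.inter ?_ ?_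
  · by_cases h : 1 ≤ i
    · simp only [h, true_imp_iff]
      exact (isOpen_lt continuous_const hc).measurableSet
    · simp only [h, false_imp_iff]
      exact MeasurableSet.univ
  · by_cases h : i + 1 ≤ n
    · simp only [h, true_imp_iff]
      exact (isOpen_lt hc continuous_const).measurableSet
    · simp only [h, false_imp_iff]
      exact MeasurableSet.univ

theorem halfSp_meas (v : EuclideanSpace ℝ (Fin d)) (s : ℝ) (b : Bool) :
    MeasurableSet (halfSp v s b) := by
  have hc : Continuous fun x : EuclideanSpace ℝ (Fin d) => (inner ℝ x v : ℝ) := by fun_prop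
  unfold halfSp
  split_ifs
  · exact (isOpen_lt hc continuous_const).measurableSet
  · exact (isOpen_lt continuous_const hc).measurableSet

open Classical in
theorem ind_eq (hg : Good μ) (k i : ℕ) (hi : i ≤ 2 * k) (u : EuclideanSpace ℝ (Fin d)) (hu : u ≠ 0)
    (x : EuclideanSpace ℝ (Fin d)) (hx : ∀ i, (inner ℝ x u : ℝ) - lev μ u (cc μ k i) ≠ 0) :
    ind μ k i u x = if x ∈ slab u (fun i => lev μ u (cc μ k i)) (2 * k) i then 1 else 0 := by
  have h1 : th μ k i u x = if (1 ≤ i → lev μ u (cc μ k i) < (inner ℝ x u : ℝ)) then 1 else -1 := by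
    unfold th
    by_cases h0 : i = 0
    · subst h0; simp
    rw [if_neg h0, if_neg (by omega)]
    have h1 : 1 ≤ i := by omega
    simp only [h1, true_imp_iff]
    split_ifs with h
    · exact sg_of_pos (by linarith)
    · refine sg_of_neg (lt_of_le_of_ne ?_ (hx i))
      linarith [not_lt.1 h]
  have h2 : th μ k (i+1) u x =
      if (i + 1 ≤ 2 * k → (inner ℝ x u : ℝ) < lev μ u (cc μ k (i+1))) then -1 else 1 := by
    unfold th
    rw [if_neg (by omega)]
    by_cases h0 : i + 1 ≤ 2 * k
    · rw [if_neg (by omega)]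
      simp only [h0, true_imp_iff]
      split_ifs with h
      · exact sg_of_neg (by linarith)
      · refine sg_of_pos (lt_of_le_of_ne ?_ (hx (i+1)).symm)
        linarith [not_lt.1 h]
    · rw [if_pos (by omega), if_pos (fun h => absurd h h0)]
  have h3 : (1 ≤ i → lev μ u (cc μ k i) < (inner ℝ x u : ℝ)) ∨
      (i + 1 ≤ 2 * k → (inner ℝ x u : ℝ) < lev μ u (cc μ k (i+1))) := by
    by_contra hcon
    rw [not_or] at hcon
    obtain ⟨ha, hb⟩ := hcon
    rw [Classical.not_imp] at ha hb
    have := lev_lt μ hg.hac hg.hpos u hu (cc μ k (i+1)) (cc μ k i) (cc_gt μ hg k _ (by omega))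
      (cc_anti μ hg k (by omega)) (cc_lt μ hg k _ ha.1)
    linarith [ha.2, hb.2]
  unfold ind slab
  rw [h1, h2]
  simp only [Set.mem_ofPred_eq]
  by_cases ha : (1 ≤ i → lev μ u (cc μ k i) < (inner ℝ x u : ℝ))
  · by_cases hb : (i + 1 ≤ 2 * k → (inner ℝ x u : ℝ) < lev μ u (cc μ k (i+1)))
    · rw [if_pos ha, if_pos hb, if_pos ⟨ha, hb⟩]; norm_num
    · rw [if_pos ha, if_neg hb, if_neg fun h => hb h.2]; norm_num
  · have hb := h3.resolve_left ha
    rw [if_neg ha, if_pos hb, if_neg fun h => ha h.1]; norm_num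

open Classical in
theorem half_eq (v : EuclideanSpace ℝ (Fin d)) (s : ℝ) (b : Bool)
    (x : EuclideanSpace ℝ (Fin d)) (hx : (inner ℝ x v : ℝ) - s ≠ 0) :
    (1 + (if b then -1 else 1) * sg (inner ℝ x v - s)) / 2 = if x ∈ halfSp v s b then 1 else 0 := by
  unfold halfSp
  rcases lt_or_gt_of_ne hx with h | h
  · rw [sg_of_neg h]
    have h1 : (inner ℝ x v : ℝ) < s := by linarith
    cases b <;> simp [h1, h1.le]
  · rw [sg_of_pos h]
    have h1 : s < (inner ℝ x v : ℝ) := by linarith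
    cases b <;> simp [h1, h1.le]

theorem box_real (hg : Good μ) (z : Fin m) (k : ℕ) (u : Fin m → EuclideanSpace ℝ (Fin d))
    (hu : ∀ j, u j ≠ 0)
    (hE : ∀ S : Finset (Fin m), S.Nonempty → z ∉ S → ∀ i ≤ 2 * k, Ei μ z k i S u = 0)
    (i : ℕ) (hi : i ≤ 2 * k) (ε : Fin m → Bool) :
    μ.real (slab (u z) (fun i => lev μ (u z) (cc μ k i)) (2 * k) i ∩
            ⋂ j ∈ univ.filter (fun j : Fin m => j ≠ z),
              halfSp (u j) (lev μ (u j) 0) (ε j)) =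
      μ.real Set.univ / (2 ^ (m - 1) * (2 * k + 1)) := by
  classical
  set N := univ.filter (fun j : Fin m => j ≠ z) with hN
  set B := slab (u z) (fun i => lev μ (u z) (cc μ k i)) (2 * k) i ∩
            ⋂ j ∈ N, halfSp (u j) (lev μ (u j) 0) (ε j) with hB
  have hcard : N.card = m - 1 := by
    rw [hN, Finset.filter_ne', Finset.card_erase_of_mem (Finset.mem_univ _), Finset.card_univ,
      Fintype.card_fin]
  have hBm : MeasurableSet B := (slab_meas _ _ _ _).inter
    (Finset.measurableSet_biInter _ fun j _ => halfSp_meas _ _ _)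
  have hz : z ∉ N := by simp [hN]
  let e : Fin m → ℝ := fun j => if ε j then -1 else 1
  have hae : ∀ᵐ x ∂μ, B.indicator (fun _ => (1 : ℝ)) x =
      (1 / 2) ^ (m - 1) * ∑ S ∈ N.powerset, (∏ j ∈ S, e j) * (ind μ k i (u z) x * pr μ S u x) := by
    have h1 : ∀ᵐ x ∂μ, ∀ i, (inner ℝ x (u z) : ℝ) - lev μ (u z) (cc μ k i) ≠ 0 :=
      ae_all_iff.2 fun i => ae_ne μ hg.hac (u z) _ (hu z)
    have h2 : ∀ᵐ x ∂μ, ∀ j : Fin m, (inner ℝ x (u j) : ℝ) - lev μ (u j) 0 ≠ 0 :=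
      ae_all_iff.2 fun j => ae_ne μ hg.hac (u j) _ (hu j)
    filter_upwards [h1, h2] with x hx1 hx2
    have h3 : ∑ S ∈ N.powerset, (∏ j ∈ S, e j) * (ind μ k i (u z) x * pr μ S u x) =
        ind μ k i (u z) x * ∏ j ∈ N, (1 + e j * sg (inner ℝ x (u j) - lev μ (u j) 0)) := by
      rw [Finset.prod_one_add, Finset.mul_sum]
      refine Finset.sum_congr rfl fun S _ => ?_
      rw [Finset.prod_mul_distrib]
      unfold pr
      ring
    have h4 : ∏ j ∈ N, (1 + e j * sg (inner ℝ x (u j) - lev μ (u j) 0)) =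
        2 ^ (m - 1) * ∏ j ∈ N, (if x ∈ halfSp (u j) (lev μ (u j) 0) (ε j) then (1 : ℝ) else 0) := by
      rw [← hcard, ← Finset.prod_const, ← Finset.prod_mul_distrib]
      refine Finset.prod_congr rfl fun j _ => ?_
      rw [← half_eq (u j) (lev μ (u j) 0) (ε j) x (hx2 j)]
      simp only [e]
      ring
    rw [h3, h4, ind_eq μ hg k i hi (u z) (hu z) x hx1, Finset.prod_boole]
    have h5 : ((1 : ℝ) / 2) ^ (m - 1) * 2 ^ (m - 1) = 1 := by
      rw [← mul_pow]; norm_num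
    rw [mul_left_comm _ ((2 : ℝ) ^ (m - 1)), ← mul_assoc, h5, one_mul, Set.indicator_apply]
    simp only [hB, Set.mem_inter_iff, Set.mem_iInter]
    split_ifs <;> simp_all
  have h6 : μ.real B = ∫ x, B.indicator (fun _ => (1 : ℝ)) x ∂μ := by
    rw [integral_indicator hBm]; simp
  rw [h6, integral_congr_ae hae, integral_const_mul,
    integral_finsetSum _ fun S _ => (Ei_int μ z k i S u).const_mul _]
  simp only [integral_const_mul]
  rw [Finset.sum_eq_single ∅]
  · have h7 : ∫ x, ind μ k i (u z) x * pr μ ∅ u x ∂μ = μ.real Set.univ / (2 * k + 1) := by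
      rw [← ind_integral μ hg k i (u z) (hu z) hi]
      simp [pr]
    rw [h7]
    simp only [Finset.prod_empty, one_mul, one_div, inv_pow]
    field_simp
  · intro S hS hne
    have := hE S (Finset.nonempty_iff_ne_empty.2 hne) (fun h => hz (Finset.mem_powerset.1 hS h)) i hi
    unfold Ei at this
    rw [this, mul_zero]
  · intro h
    simp at h

theorem box_meas (hg : Good μ) (z : Fin m) (k : ℕ) (u : Fin m → EuclideanSpace ℝ (Fin d))
    (hu : ∀ j, u j ≠ 0)
    (hE : ∀ S : Finset (Fin m), S.Nonempty → z ∉ S → ∀ i ≤ 2 * k, Ei μ z k i S u = 0)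
    (i : ℕ) (hi : i ≤ 2 * k) (ε : Fin m → Bool) :
    μ (slab (u z) (fun i => lev μ (u z) (cc μ k i)) (2 * k) i ∩
            ⋂ j ∈ univ.filter (fun j : Fin m => j ≠ z),
              halfSp (u j) (lev μ (u j) 0) (ε j)) =
      μ Set.univ / ((2 ^ (m - 1) * (2 * k + 1) : ℕ) : ENNReal) := by
  have h := box_real μ hg z k u hu hE i hi ε
  have hn : ((2 ^ (m - 1) * (2 * k + 1) : ℕ) : ENNReal) ≠ 0 := by
    have : 2 ^ (m - 1) * (2 * k + 1) ≠ 0 := by positivity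
    exact_mod_cast this
  refine (ENNReal.toReal_eq_toReal_iff' (measure_ne_top _ _)
    (ENNReal.div_ne_top (measure_ne_top _ _) hn)).1 ?_
  rw [ENNReal.toReal_div, ENNReal.toReal_natCast]
  push_cast
  exact h

theorem box_nonempty (hg : Good μ) (z : Fin m) (k : ℕ) (u : Fin m → EuclideanSpace ℝ (Fin d))
    (hu : ∀ j, u j ≠ 0)
    (hE : ∀ S : Finset (Fin m), S.Nonempty → z ∉ S → ∀ i ≤ 2 * k, Ei μ z k i S u = 0)
    (ε : Fin m → Bool) : ∃ x : EuclideanSpace ℝ (Fin d),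
      (1 ≤ 2 * k → (inner ℝ x (u z) : ℝ) < lev μ (u z) (cc μ k 1)) ∧
      ∀ j, j ≠ z → x ∈ halfSp (u j) (lev μ (u j) 0) (ε j) := by
  have h := box_real μ hg z k u hu hE 0 (by omega) ε
  have hpos : 0 < μ.real Set.univ / (2 ^ (m - 1) * (2 * k + 1)) :=
    div_pos (Wpos μ hg) (by positivity)
  rw [← h] at hpos
  have hne := nonempty_of_measureReal_ne_zero hpos.ne'
  obtain ⟨x, hx1, hx2⟩ := hne
  refine ⟨x, hx1.2, fun j hj => ?_⟩
  rw [Set.mem_iInter₂] at hx2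
  exact hx2 j (by simp [hj])

theorem not_par_aux (hg : Good μ) (z : Fin m) (k : ℕ) (hk : 1 ≤ k)
    (u : Fin m → EuclideanSpace ℝ (Fin d))
    (hu : ∀ j, u j ≠ 0)
    (hE : ∀ S : Finset (Fin m), S.Nonempty → z ∉ S → ∀ i ≤ 2 * k, Ei μ z k i S u = 0)
    (l : Fin m) (hl : l ≠ z) : u z ≠ u l ∧ u z ≠ - u l := by
  have hlt : lev μ (u z) (cc μ k 1) < lev μ (u z) 0 := by
    refine lev_lt μ hg.hac hg.hpos (u z) (hu z) 0 _ (by linarith [Wpos μ hg]) ?_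
      (cc_lt μ hg k 1 le_rfl)
    unfold cc
    refine mul_pos (Wpos μ hg) ?_
    have hk' : (1 : ℝ) ≤ k := by exact_mod_cast hk
    rw [sub_pos, div_lt_one (by positivity)]
    push_cast
    linarith
  constructor
  · intro h
    obtain ⟨x, h1, h2⟩ := box_nonempty μ hg z k u hu hE (fun _ => false)
    have h3 := h2 l hl
    have h4 := h1 (by omega)
    rw [← h] at h3
    simp only [halfSp, Bool.false_eq_true, if_false, Set.mem_ofPred_eq] at h3
    linarith
  · intro h
    obtain ⟨x, h1, h2⟩ := box_nonempty μ hg z k u hu hE (fun _ => true)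
    have h3 := h2 l hl
    have h4 := h1 (by omega)
    have h5 : u l = - u z := by rw [h, neg_neg]
    rw [h5, lev0_neg μ hg _ (hu z)] at h3
    simp only [halfSp, if_true, Set.mem_ofPred_eq, inner_neg_right] at h3
    linarith

theorem not_par (hg : Good μ) (z : Fin m) (k : ℕ) (hk : 1 ≤ k)
    (u : Fin m → EuclideanSpace ℝ (Fin d))
    (hu : ∀ j, u j ≠ 0)
    (hE : ∀ S : Finset (Fin m), S.Nonempty → z ∉ S → ∀ i ≤ 2 * k, Ei μ z k i S u = 0)
    (j l : Fin m) (hjl : j ≠ l) : u j ≠ u l ∧ u j ≠ - u l := by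
  by_cases hj : j = z
  · subst hj
    exact not_par_aux μ hg j k hk u hu hE l hjl.symm
  by_cases hl : l = z
  · subst hl
    obtain ⟨h1, h2⟩ := not_par_aux μ hg l k hk u hu hE j hj
    refine ⟨fun h => h1 h.symm, fun h => h2 ?_⟩
    rw [h, neg_neg]
  constructor
  · intro h
    obtain ⟨x, h1, h2⟩ := box_nonempty μ hg z k u hu hE (fun i => if i = j then true else false)
    have h3 := h2 j hj
    have h4 := h2 l hl
    rw [if_pos rfl, h] at h3
    rw [if_neg hjl.symm] at h4
    simp only [halfSp, Bool.false_eq_true, if_true, if_false, Set.mem_ofPred_eq] at h3 h4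
    linarith
  · intro h
    obtain ⟨x, h1, h2⟩ := box_nonempty μ hg z k u hu hE (fun _ => true)
    have h3 := h2 j hj
    have h4 := h2 l hl
    rw [h, lev0_neg μ hg _ (hu l)] at h3
    simp only [halfSp, if_true, Set.mem_ofPred_eq, inner_neg_right] at h3 h4
    linarith

theorem hyper_null (u : EuclideanSpace ℝ (Fin d)) (t : ℝ) (hu : u ≠ 0) :
    (volume : Measure (EuclideanSpace ℝ (Fin d))) {x | (inner ℝ x u : ℝ) = t} = 0 := by
  have hn : ‖u‖ ≠ 0 := by simpa using hu
  let K : Submodule ℝ (EuclideanSpace ℝ (Fin d)) := LinearMap.ker (innerₗ (EuclideanSpace ℝ (Fin d)) u)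
  have hK : (volume : Measure (EuclideanSpace ℝ (Fin d))) (K : Set _) = 0 := by
    refine Measure.addHaar_submodule _ K ?_
    intro h
    have : u ∈ K := by rw [h]; trivial
    have h2 : (inner ℝ u u : ℝ) = 0 := this
    rw [inner_self_eq_zero] at h2
    exact hu h2
  have : {x : EuclideanSpace ℝ (Fin d) | (inner ℝ x u : ℝ) = t} =
      (fun x => x + (-(t / ‖u‖ ^ 2)) • u) ⁻¹' (K : Set (EuclideanSpace ℝ (Fin d))) := by
    ext x
    have h1 : x + (-(t / ‖u‖ ^ 2)) • u ∈ K ↔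
      (inner ℝ u (x + (-(t / ‖u‖ ^ 2)) • u) : ℝ) = 0 := Iff.rfl
    rw [Set.mem_preimage, SetLike.mem_coe, h1, inner_add_right, real_inner_smul_right,
      real_inner_self_eq_norm_sq, Set.mem_ofPred_eq, real_inner_comm, neg_mul,
      div_mul_cancel₀ _ (pow_ne_zero 2 hn)]
    constructor <;> intro h <;> linarith
  rw [this, measure_preimage_add_right]
  exact hK

end Box
end EqP

open MvPolynomial Finset in
/-- The general even case: if
`(1/(x₂⋯x_m))·𝔓_{m-1}(x₂,…,x_m)·(𝔓_m/x₁)^k ∉ (x₁^d, …, x_m^d)` in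
`(ℤ/2)[x₁,…,x_m]`, then every mass distribution in `ℝ^d` admits an
equipartition into `(2k+1)×2×⋯×2` boxes by `2k` parallel hyperplanes and
`m-1` additional pairwise non-parallel hyperplanes. -/
theorem equipartition_general_even (m k d : ℕ) (hm : 2 ≤ m) (hk : 1 ≤ k) (hd : 2 ≤ d)
    (hQ : (∏ i ∈ univ.filter (fun i : Fin m => i ≠ ⟨0, by omega⟩),
            (X i : MvPolynomial (Fin m) (ZMod 2)) ^ k) *
          (∏ S ∈ univ.filter
              (fun S : Finset (Fin m) => 2 ≤ S.card ∧ (⟨0, by omega⟩ : Fin m) ∉ S),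
            ∑ i ∈ S, X i) *
          (∏ S ∈ univ.filter (fun S : Finset (Fin m) => 2 ≤ S.card),
            ∑ i ∈ S, X i) ^ k ∉
      Ideal.span (Set.range fun i : Fin m => (X i : MvPolynomial (Fin m) (ZMod 2)) ^ d))
    (μ : Measure (EuclideanSpace ℝ (Fin d)))
    (f : EuclideanSpace ℝ (Fin d) → ℝ) (hf : Integrable f)
    (hμ : ∀ A : Set (EuclideanSpace ℝ (Fin d)), MeasurableSet A →
      μ A = ENNReal.ofReal (∫ x in A, f x))
    (hpos : ∀ U : Set (EuclideanSpace ℝ (Fin d)), IsOpen U → U.Nonempty → 0 < μ U) :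
    ∃ (u : Fin m → EuclideanSpace ℝ (Fin d)) (t : ℕ → ℝ) (s : Fin m → ℝ),
      (∀ j, ‖u j‖ = 1) ∧
      (∀ j l, j ≠ l → u j ≠ u l ∧ u j ≠ -u l) ∧
      StrictMonoOn t (Set.Icc 1 (2 * k)) ∧
      ∀ i ≤ 2 * k, ∀ ε : Fin m → Bool,
        μ (slab (u ⟨0, by omega⟩) t (2 * k) i ∩
            ⋂ j ∈ univ.filter (fun j : Fin m => j ≠ ⟨0, by omega⟩),
              halfSp (u j) (s j) (ε j)) =
          μ Set.univ / ((2 ^ (m - 1) * (2 * k + 1) : ℕ) : ENNReal) := by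
  have : IsFiniteMeasure μ := ⟨by rw [hμ _ MeasurableSet.univ]; exact ENNReal.ofReal_lt_top⟩
  have hg : EqP.Good μ := by
    refine ⟨fun u t hu => ?_, hpos⟩
    have hc : Continuous fun x : EuclideanSpace ℝ (Fin d) => (inner ℝ x u : ℝ) := by fun_prop
    rw [hμ _ (isClosed_eq hc continuous_const).measurableSet,
      setIntegral_measure_zero _ (EqP.hyper_null u t hu), ENNReal.ofReal_zero]
  obtain ⟨u, hu, hE⟩ := EqP.exists_zero μ hg (by omega) (⟨0, by omega⟩ : Fin m) k hQ
  have hne : ∀ j, u j ≠ 0 := by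
    intro i h
    have := hu i
    rw [h, norm_zero] at this
    exact zero_ne_one this
  refine ⟨u, fun i => EqP.lev μ (u ⟨0, by omega⟩) (EqP.cc μ k i), fun j => EqP.lev μ (u j) 0,
    hu, EqP.not_par μ hg _ k hk u hne hE, ?_, EqP.box_meas μ hg _ k u hne hE⟩
  intro i hi j hj hij
  exact EqP.lev_lt μ hg.hac hg.hpos _ (hne _) _ _ (EqP.cc_gt μ hg k j (by have := hj.2; omega))
    (EqP.cc_anti μ hg k hij) (EqP.cc_lt μ hg k i hi.1)
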